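/- arXiv:1707.01566 — 4 statements merged into one kernel-verified Lean document; each statement's English description precedes it below -/
import Mathlib

section
/- Let d ≥ 1 and s ∈ (0,1), and use the Fourier convention F w(ξ) = ∫_{ℝ^d} w(x) e^{−i x·ξ} dx. Let η, θ : ℝ^d → ℝ be Schwartz functions. For each μ > 0 let v_μ be the Schwartz function determined by F v_μ(ξ) = − F η(ξ)/(1+μ²|ξ|²) (equivalently, v_μ is the unique tempered solution of v_μ − μ²Δv_μ = −η). Then the map μ ↦ μ^{−1−2s} ∫_{ℝ^d} (η(x)+v_μ(x)) θ(x) dx is absolutely integrable on (0,∞) and (2 sin(sπ)/π) ∫₀^∞ μ^{−1−2s} ( ∫_{ℝ^d} (η(x)+v_μ(x)) θ(x) dx ) dμ = (2π)^{−d} ∫_{ℝ^d} |ξ|^{2s} F η(ξ) conj(F θ(ξ)) dξ. -/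
open MeasureTheory Real Set
open scoped RealInnerProductSpace

/-- Fourier transform with the convention `F w (ξ) = ∫ w(x) e^{-i x·ξ} dx`. -/
noncomputable def fourierConv {d : ℕ} (w : EuclideanSpace ℝ (Fin d) → ℝ)
    (ξ : EuclideanSpace ℝ (Fin d)) : ℂ :=
  ∫ x : EuclideanSpace ℝ (Fin d), (w x : ℂ) * Complex.exp (-Complex.I * (⟪x, ξ⟫ : ℝ))

theorem integral_Ioo_rpow_mul_one_sub_rpow {s : ℝ} (hs : s ∈ Set.Ioo (0 : ℝ) 1) :
    ∫ x in Set.Ioo (0 : ℝ) 1, x ^ (s - 1) * (1 - x) ^ (-s) = π / Real.sin (s * π) := by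
  have h := ProbabilityTheory.beta_eq_betaIntegralReal s (1 - s) hs.1 (by linarith [hs.2])
  rw [ProbabilityTheory.beta, add_sub_cancel, Real.Gamma_one, div_one,
    Real.Gamma_mul_Gamma_one_sub, Complex.betaIntegral,
    intervalIntegral.integral_of_le zero_le_one, integral_Ioc_eq_integral_Ioo] at h
  rw [mul_comm s π, h, ← Complex.ofReal_re (∫ x in Set.Ioo (0 : ℝ) 1, _), ← integral_complex_ofReal]
  congr 1
  refine setIntegral_congr_fun measurableSet_Ioo fun x hx => ?_
  have h1 : (0 : ℝ) ≤ 1 - x := by linarith [hx.2]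
  rw [Complex.ofReal_mul, Complex.ofReal_cpow hx.1.le, Complex.ofReal_cpow h1]
  push_cast
  congr 2
  ring

theorem image_Ioi_inv_one_add_sq {r : ℝ} (hr : 0 < r) :
    (fun μ : ℝ => (1 + μ ^ 2 * r ^ 2)⁻¹) '' Set.Ioi 0 = Set.Ioo 0 1 := by
  ext x
  simp only [Set.mem_image, Set.mem_Ioi, Set.mem_Ioo]
  constructor
  · rintro ⟨μ, hμ, rfl⟩
    have : 0 < μ ^ 2 * r ^ 2 := by positivity
    exact ⟨by positivity, inv_lt_one_of_one_lt₀ (by linarith)⟩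
  · rintro ⟨h0, h1⟩
    have h2 : 0 < x⁻¹ - 1 := by linarith [(one_lt_inv₀ h0).2 h1]
    refine ⟨√(x⁻¹ - 1) / r, by positivity, ?_⟩
    rw [div_pow, Real.sq_sqrt h2.le, div_mul_cancel₀ _ (by positivity)]
    simp

theorem setIntegral_Ioi_rpow_mul_sq_div {s : ℝ} (hs : s ∈ Set.Ioo (0 : ℝ) 1) {r : ℝ}
    (hr : 0 ≤ r) :
    ∫ μ in Set.Ioi (0 : ℝ), μ ^ (-1 - 2 * s) * (μ ^ 2 * r ^ 2 / (1 + μ ^ 2 * r ^ 2)) =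
      r ^ (2 * s) * (π / (2 * Real.sin (s * π))) := by
  rcases hr.eq_or_lt with rfl | hr
  · simp [Real.zero_rpow (mul_pos two_pos hs.1).ne']
  have hderiv : ∀ μ ∈ Set.Ioi (0 : ℝ), HasDerivWithinAt (fun μ : ℝ => (1 + μ ^ 2 * r ^ 2)⁻¹)
      (-(2 * μ * r ^ 2) / (1 + μ ^ 2 * r ^ 2) ^ 2) (Set.Ioi 0) μ := by
    intro μ hμ
    have h1 : HasDerivAt (fun μ : ℝ => 1 + μ ^ 2 * r ^ 2) (2 * μ * r ^ 2) μ := by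
      simpa using ((hasDerivAt_pow 2 μ).mul_const (r ^ 2)).const_add 1
    exact (h1.fun_inv (by positivity)).hasDerivWithinAt
  have hinj : Set.InjOn (fun μ : ℝ => (1 + μ ^ 2 * r ^ 2)⁻¹) (Set.Ioi 0) := by
    intro a ha b hb hab
    have h1 := inv_injective hab
    have h2 : a ^ 2 = b ^ 2 := mul_right_cancel₀ (pow_ne_zero 2 hr.ne') (by linarith)
    exact (sq_eq_sq₀ (Set.mem_Ioi.1 ha).le (Set.mem_Ioi.1 hb).le).1 h2
  have h := integral_image_eq_integral_abs_deriv_smul measurableSet_Ioi hderiv hinj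
    (fun x => x ^ (s - 1) * (1 - x) ^ (-s))
  rw [image_Ioi_inv_one_add_sq hr, integral_Ioo_rpow_mul_one_sub_rpow hs] at h
  have key : ∀ μ ∈ Set.Ioi (0 : ℝ), μ ^ (-1 - 2 * s) * (μ ^ 2 * r ^ 2 / (1 + μ ^ 2 * r ^ 2)) =
      r ^ (2 * s) / 2 * (|-(2 * μ * r ^ 2) / (1 + μ ^ 2 * r ^ 2) ^ 2| •
        (((1 + μ ^ 2 * r ^ 2)⁻¹) ^ (s - 1) * (1 - (1 + μ ^ 2 * r ^ 2)⁻¹) ^ (-s))) := by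
    intro μ hμ
    have hμ : 0 < μ := hμ
    have hA : 0 < 1 + μ ^ 2 * r ^ 2 := by positivity
    have e1 : 1 - (1 + μ ^ 2 * r ^ 2)⁻¹ = (μ * r) ^ 2 * (1 + μ ^ 2 * r ^ 2)⁻¹ := by
      field_simp; ring
    have e2 : ((μ * r) ^ 2) ^ (-s) = μ ^ (-(2 * s)) * (r ^ (2 * s))⁻¹ := by
      rw [← Real.rpow_natCast, ← Real.rpow_mul (by positivity), Real.mul_rpow hμ.le hr.le,
        ← Real.rpow_neg hr.le]
      congr 2 <;> (push_cast; ring)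
    have e3 : ((1 + μ ^ 2 * r ^ 2)⁻¹) ^ (s - 1) * ((1 + μ ^ 2 * r ^ 2)⁻¹) ^ (-s) =
        1 + μ ^ 2 * r ^ 2 := by
      rw [← Real.rpow_add (by positivity), show s - 1 + -s = -1 by ring, Real.rpow_neg_one, inv_inv]
    have e4 : μ ^ (-1 - 2 * s) = μ⁻¹ * μ ^ (-(2 * s)) := by
      rw [← Real.rpow_neg_one, ← Real.rpow_add hμ]; congr 1
    rw [neg_div, abs_neg, abs_of_pos (by positivity), e1, Real.mul_rpow (by positivity)
      (by positivity), mul_left_comm, e3, e2, e4, smul_eq_mul]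
    have : r ^ (2 * s) ≠ 0 := (Real.rpow_pos_of_pos hr _).ne'
    field_simp
  rw [setIntegral_congr_fun measurableSet_Ioi key, integral_const_mul, ← h]
  ring

theorem integrableOn_Ioi_rpow_mul_sq_div {s : ℝ} (hs : s ∈ Set.Ioo (0 : ℝ) 1) {r : ℝ}
    (hr : 0 ≤ r) :
    IntegrableOn (fun μ : ℝ => μ ^ (-1 - 2 * s) * (μ ^ 2 * r ^ 2 / (1 + μ ^ 2 * r ^ 2)))
      (Set.Ioi 0) := by
  rcases hr.eq_or_lt with rfl | hr
  · simp
  refine not_imp_comm.1 integral_undef ?_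
  rw [setIntegral_Ioi_rpow_mul_sq_div hs hr.le]
  have : 0 < Real.sin (s * π) :=
    Real.sin_pos_of_pos_of_lt_pi (mul_pos hs.1 pi_pos) (by nlinarith [hs.2, pi_pos])
  positivity

theorem exists_schwartzMap_ofReal {d : ℕ} (f : SchwartzMap (EuclideanSpace ℝ (Fin d)) ℝ) :
    ∃ g : SchwartzMap (EuclideanSpace ℝ (Fin d)) ℂ, ∀ x, g x = (f x : ℂ) :=
  ⟨SchwartzMap.bilinLeftCLM (ContinuousLinearMap.lsmul ℝ ℝ)
    (Function.HasTemperateGrowth.const (1 : ℂ)) f, fun x => by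
      simp⟩

open scoped FourierTransform in
theorem fourierConv_eq_fourier {d : ℕ} (w : EuclideanSpace ℝ (Fin d) → ℝ)
    (ξ : EuclideanSpace ℝ (Fin d)) :
    fourierConv w ξ = 𝓕 (fun x => (w x : ℂ)) ((2 * π)⁻¹ • ξ) := by
  rw [Real.fourier_eq', fourierConv]
  congr 1 with x
  rw [smul_eq_mul, mul_comm, inner_smul_right]
  congr 2
  have : (π : ℂ) ≠ 0 := by exact_mod_cast pi_ne_zero
  push_cast
  field_simp

open scoped FourierTransform in
theorem exists_schwartzMap_fourierConv {d : ℕ}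
    (f : SchwartzMap (EuclideanSpace ℝ (Fin d)) ℝ) :
    ∃ g : SchwartzMap (EuclideanSpace ℝ (Fin d)) ℂ, ∀ ξ, g ξ = fourierConv (fun x => f x) ξ := by
  obtain ⟨F, hF⟩ := exists_schwartzMap_ofReal f
  refine ⟨SchwartzMap.compCLMOfContinuousLinearEquiv ℂ
    (ContinuousLinearEquiv.smulLeft (Units.mk0 ((2 * π)⁻¹ : ℝ) (by positivity))) (𝓕 F),
    fun ξ => ?_⟩
  rw [fourierConv_eq_fourier, ← funext hF, ← SchwartzMap.fourier_coe]
  rfl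

open scoped FourierTransform in
theorem integral_mul_eq_integral_fourierConv {d : ℕ}
    (f g : SchwartzMap (EuclideanSpace ℝ (Fin d)) ℝ) :
    ((∫ x, f x * g x : ℝ) : ℂ) = (((2 * π) ^ (-(d : ℝ)) : ℝ) : ℂ) *
      ∫ ξ, fourierConv (fun x => f x) ξ * (starRingEnd ℂ) (fourierConv (fun x => g x) ξ) := by
  obtain ⟨F, hF⟩ := exists_schwartzMap_ofReal f
  obtain ⟨G, hG⟩ := exists_schwartzMap_ofReal g
  have h := SchwartzMap.integral_inner_fourier_fourier G F
  simp only [RCLike.inner_apply, hF, hG, Complex.conj_ofReal] at h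
  simp only [fourierConv_eq_fourier, ← funext hF, ← funext hG, ← SchwartzMap.fourier_coe]
  rw [Measure.integral_comp_inv_smul_of_nonneg volume
    (fun ξ => 𝓕 F ξ * (starRingEnd ℂ) (𝓕 G ξ)) (by positivity : (0 : ℝ) ≤ 2 * π), h,
    finrank_euclideanSpace_fin, Complex.real_smul, ← mul_assoc, ← Complex.ofReal_mul,
    Real.rpow_neg (by positivity), Real.rpow_natCast, inv_mul_cancel₀ (by positivity),
    Complex.ofReal_one, one_mul, ← integral_complex_ofReal]
  simp

theorem integrable_norm_rpow_mul_schwartzMap {d : ℕ} {p : ℝ} (hp : p ∈ Set.Icc (0 : ℝ) 2)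
    (F : SchwartzMap (EuclideanSpace ℝ (Fin d)) ℂ) :
    Integrable fun ξ => ‖ξ‖ ^ p * ‖F ξ‖ := by
  refine (F.integrable.norm.add (F.integrable_pow_mul volume 2)).mono'
    (((continuous_norm.rpow_const fun _ => Or.inr hp.1).mul F.continuous.norm).aestronglyMeasurable)
    (Filter.Eventually.of_forall fun ξ => ?_)
  rw [Real.norm_of_nonneg (by positivity), Pi.add_apply]
  have : ‖ξ‖ ^ p ≤ 1 + ‖ξ‖ ^ 2 := by
    rcases le_total ‖ξ‖ 1 with h | h
    · linarith [Real.rpow_le_one (norm_nonneg ξ) h hp.1, sq_nonneg ‖ξ‖]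
    · have := Real.rpow_le_rpow_of_exponent_le h hp.2
      rw [Real.rpow_two] at this
      linarith
  nlinarith [norm_nonneg (F ξ)]

theorem integrable_prod_kernel_mul {d : ℕ} {s : ℝ} (hs : s ∈ Set.Ioo (0 : ℝ) 1)
    {h : EuclideanSpace ℝ (Fin d) → ℂ} (hh : Continuous h)
    (hint : Integrable fun ξ => ‖ξ‖ ^ (2 * s) * ‖h ξ‖) :
    Integrable (Function.uncurry fun (μ : ℝ) (ξ : EuclideanSpace ℝ (Fin d)) =>
      ((μ ^ (-1 - 2 * s) * (μ ^ 2 * ‖ξ‖ ^ 2 / (1 + μ ^ 2 * ‖ξ‖ ^ 2)) : ℝ) : ℂ) * h ξ)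
      ((volume.restrict (Set.Ioi 0)).prod volume) := by
  have hm := hh.measurable
  refine (integrable_prod_iff' (Measurable.aestronglyMeasurable ?_)).2
    ⟨Filter.Eventually.of_forall fun ξ => ?_, ?_⟩
  · unfold Function.uncurry
    fun_prop
  · exact (integrableOn_Ioi_rpow_mul_sq_div hs (norm_nonneg ξ)).ofReal.mul_const (h ξ)
  · refine (hint.mul_const (π / (2 * Real.sin (s * π)))).congr
      (Filter.Eventually.of_forall fun ξ => ?_)
    dsimp only [Function.uncurry]
    rw [mul_right_comm, ← setIntegral_Ioi_rpow_mul_sq_div hs (norm_nonneg ξ),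
      ← integral_mul_const]
    refine setIntegral_congr_fun measurableSet_Ioi fun μ hμ => ?_
    have hμ : 0 < μ := hμ
    rw [norm_mul, Complex.norm_real, Real.norm_of_nonneg (by positivity)]

theorem integral_integral_kernel_mul {d : ℕ} {s : ℝ} (hs : s ∈ Set.Ioo (0 : ℝ) 1)
    {h : EuclideanSpace ℝ (Fin d) → ℂ} (hh : Continuous h)
    (hint : Integrable fun ξ => ‖ξ‖ ^ (2 * s) * ‖h ξ‖) :
    ∫ μ in Set.Ioi (0 : ℝ), ∫ ξ,
      ((μ ^ (-1 - 2 * s) * (μ ^ 2 * ‖ξ‖ ^ 2 / (1 + μ ^ 2 * ‖ξ‖ ^ 2)) : ℝ) : ℂ) * h ξ =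
    ((π / (2 * Real.sin (s * π)) : ℝ) : ℂ) * ∫ ξ, ((‖ξ‖ ^ (2 * s) : ℝ) : ℂ) * h ξ := by
  rw [integral_integral_swap (integrable_prod_kernel_mul hs hh hint), ← integral_const_mul]
  congr 1 with ξ
  rw [integral_mul_const, integral_complex_ofReal,
    setIntegral_Ioi_rpow_mul_sq_div hs (norm_nonneg ξ)]
  push_cast
  ring

open scoped FourierTransform in
theorem fourierConv_add {d : ℕ} (f g : SchwartzMap (EuclideanSpace ℝ (Fin d)) ℝ)
    (ξ : EuclideanSpace ℝ (Fin d)) :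
    fourierConv (fun x => f x + g x) ξ = fourierConv (fun x => f x) ξ +
      fourierConv (fun x => g x) ξ := by
  obtain ⟨F, hF⟩ := exists_schwartzMap_ofReal f
  obtain ⟨G, hG⟩ := exists_schwartzMap_ofReal g
  have hFG : ∀ x, (F + G) x = ((f x + g x : ℝ) : ℂ) := fun x => by simp [hF, hG]
  rw [fourierConv_eq_fourier, fourierConv_eq_fourier, fourierConv_eq_fourier, ← funext hF,
    ← funext hG, ← funext hFG, ← SchwartzMap.fourier_coe, ← SchwartzMap.fourier_coe,
    ← SchwartzMap.fourier_coe, FourierTransform.fourier_add, add_apply]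

theorem rpow_mul_integral_resolvent_eq {d : ℕ} {μ : ℝ} (p : ℝ)
    {η θ w : SchwartzMap (EuclideanSpace ℝ (Fin d)) ℝ}
    (hw : ∀ ξ, fourierConv (fun x => w x) ξ =
      -fourierConv (fun x => η x) ξ / ((1 + μ ^ 2 * ‖ξ‖ ^ 2 : ℝ) : ℂ)) :
    ((μ ^ p * ∫ x, (η x + w x) * θ x : ℝ) : ℂ) = (((2 * π) ^ (-(d : ℝ)) : ℝ) : ℂ) *
      ∫ ξ, ((μ ^ p * (μ ^ 2 * ‖ξ‖ ^ 2 / (1 + μ ^ 2 * ‖ξ‖ ^ 2)) : ℝ) : ℂ) *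
        (fourierConv (fun x => η x) ξ * (starRingEnd ℂ) (fourierConv (fun x => θ x) ξ)) := by
  have h : ((∫ x, (η x + w x) * θ x : ℝ) : ℂ) = (((2 * π) ^ (-(d : ℝ)) : ℝ) : ℂ) *
      ∫ ξ, fourierConv (fun x => η x + w x) ξ *
        (starRingEnd ℂ) (fourierConv (fun x => θ x) ξ) :=
    integral_mul_eq_integral_fourierConv (η + w) θ
  rw [Complex.ofReal_mul, h, mul_left_comm, ← integral_const_mul]
  congr 2 with ξ
  have : ((1 + μ ^ 2 * ‖ξ‖ ^ 2 : ℝ) : ℂ) ≠ 0 := by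
    exact_mod_cast (by positivity : (0 : ℝ) < 1 + μ ^ 2 * ‖ξ‖ ^ 2).ne'
  rw [fourierConv_add, hw]
  push_cast at this ⊢
  field_simp
  ring

/-- Dunford–Taylor representation of the bilinear form of the integral fractional
Laplacian on Schwartz functions: with `v_μ` the Schwartz solution of
`v_μ - μ²Δv_μ = -η` (characterized on the Fourier side by
`F v_μ = -F η/(1+μ²|ξ|²)`), the map `μ ↦ μ^(-1-2s) ∫ (η+v_μ)θ` is absolutely integrable
on `(0,∞)` and
`(2 sin(sπ)/π) ∫₀^∞ μ^(-1-2s) (∫ (η+v_μ)θ dx) dμ = (2π)^(-d) ∫ |ξ|^(2s) Fη conj(Fθ) dξ`. -/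
theorem dunford_taylor_bilinear_form_schwartz
    (d : ℕ) (hd : 1 ≤ d) (s : ℝ) (hs : s ∈ Set.Ioo (0 : ℝ) 1)
    (η θ : SchwartzMap (EuclideanSpace ℝ (Fin d)) ℝ)
    (v : ℝ → SchwartzMap (EuclideanSpace ℝ (Fin d)) ℝ)
    (hv : ∀ μ : ℝ, 0 < μ → ∀ ξ : EuclideanSpace ℝ (Fin d),
      fourierConv (fun x => v μ x) ξ =
        -fourierConv (fun x => η x) ξ / ((1 + μ ^ 2 * ‖ξ‖ ^ 2 : ℝ) : ℂ)) :
    MeasureTheory.IntegrableOn (fun μ : ℝ =>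
        μ ^ (-1 - 2 * s) * ∫ x : EuclideanSpace ℝ (Fin d), (η x + v μ x) * θ x)
      (Set.Ioi 0) ∧
      ((2 * Real.sin (s * π) / π *
          ∫ μ in Set.Ioi (0 : ℝ),
            μ ^ (-1 - 2 * s) * ∫ x : EuclideanSpace ℝ (Fin d), (η x + v μ x) * θ x : ℝ) : ℂ) =
        (((2 * π) ^ (-(d : ℝ)) : ℝ) : ℂ) *
          ∫ ξ : EuclideanSpace ℝ (Fin d),
            ((‖ξ‖ ^ (2 * s) : ℝ) : ℂ) * fourierConv (fun x => η x) ξ *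
              (starRingEnd ℂ) (fourierConv (fun x => θ x) ξ) := by
  obtain ⟨A, hA⟩ := exists_schwartzMap_fourierConv η
  obtain ⟨B, hB⟩ := exists_schwartzMap_fourierConv θ
  have hcont : Continuous fun ξ => A ξ * (starRingEnd ℂ) (B ξ) :=
    A.continuous.mul (Complex.continuous_conj.comp B.continuous)
  have hint : Integrable fun ξ => ‖ξ‖ ^ (2 * s) * ‖A ξ * (starRingEnd ℂ) (B ξ)‖ := by
    refine ((integrable_norm_rpow_mul_schwartzMap (p := 2 * s)
      ⟨by linarith [hs.1], by linarith [hs.2]⟩ A).mul_bdd (g := fun ξ => ‖B ξ‖)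
      (c := SchwartzMap.seminorm ℝ 0 0 B) B.continuous.norm.aestronglyMeasurable
      (Filter.Eventually.of_forall fun ξ => ?_)).congr (Filter.Eventually.of_forall fun ξ => ?_)
    · rw [norm_norm]
      exact SchwartzMap.norm_le_seminorm ℝ B ξ
    · simp [mul_assoc]
  have hrep : ∀ μ ∈ Set.Ioi (0 : ℝ),
      ((μ ^ (-1 - 2 * s) * ∫ x, (η x + v μ x) * θ x : ℝ) : ℂ) =
      (((2 * π) ^ (-(d : ℝ)) : ℝ) : ℂ) *
      ∫ ξ, ((μ ^ (-1 - 2 * s) * (μ ^ 2 * ‖ξ‖ ^ 2 / (1 + μ ^ 2 * ‖ξ‖ ^ 2)) : ℝ) : ℂ) *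
        (A ξ * (starRingEnd ℂ) (B ξ)) := fun μ hμ => by
    simp only [hA, hB]
    exact rpow_mul_integral_resolvent_eq _ (hv μ hμ)
  have hsin : Real.sin (s * π) ≠ 0 :=
    (Real.sin_pos_of_pos_of_lt_pi (mul_pos hs.1 pi_pos) (by nlinarith [hs.2, pi_pos])).ne'
  constructor
  · have h1 := ((integrable_prod_kernel_mul hs hcont hint).integral_prod_left.const_mul
      (((2 * π) ^ (-(d : ℝ)) : ℝ) : ℂ))
    have h2 : IntegrableOn (fun μ : ℝ =>
        ((μ ^ (-1 - 2 * s) * ∫ x, (η x + v μ x) * θ x : ℝ) : ℂ)) (Set.Ioi 0) :=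
      IntegrableOn.congr_fun h1 (fun μ hμ => (hrep μ hμ).symm) measurableSet_Ioi
    exact h2.re
  · rw [Complex.ofReal_mul, ← integral_complex_ofReal,
      setIntegral_congr_fun measurableSet_Ioi hrep, integral_const_mul,
      integral_integral_kernel_mul hs hcont hint]
    simp only [← hA, ← hB, mul_assoc]
    rw [mul_left_comm (((2 * π) ^ (-(d : ℝ)) : ℝ) : ℂ), ← mul_assoc, ← Complex.ofReal_mul,
      show 2 * Real.sin (s * π) / π * (π / (2 * Real.sin (s * π))) = 1 by field_simp,
      Complex.ofReal_one, one_mul]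
end

section
/- Let d ≥ 1, s ∈ (0,1), and let u : ℝ^d → ℝ be defined by u(x) = (1−|x|²)^s for |x| < 1 and u(x) = 0 for |x| ≥ 1. Then for every x₀ ∈ ℝ^d with |x₀| < 1, the function y ↦ (2u(x₀) − u(x₀+y) − u(x₀−y))/|y|^{d+2s} is Lebesgue integrable on ℝ^d and (C(d,s)/2) ∫_{ℝ^d} (2u(x₀) − u(x₀+y) − u(x₀−y))/|y|^{d+2s} dy = 2^{2s} Γ((d+2s)/2) Γ(1+s) / Γ(d/2). Equivalently, the function x ↦ (Γ(d/2)/(2^{2s} Γ((d+2s)/2) Γ(1+s))) (1−|x|²)_+^s solves (−Δ)^s u = 1 in the open unit ball, with zero values outside the ball. -/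
open MeasureTheory Real Set

/-- The normalization constant `C(d,s) = 2^(2s) s Γ(s+d/2) / (π^(d/2) Γ(1-s))` of the
integral fractional Laplacian. -/
noncomputable def fracLapConst (d : ℕ) (s : ℝ) : ℝ :=
  2 ^ (2 * s) * s * Real.Gamma (s + d / 2) / (π ^ ((d : ℝ) / 2) * Real.Gamma (1 - s))

/-- The Getoor function `u(x) = (1-|x|²)₊^s` (equal to `(1-|x|²)^s` for `|x| < 1` and to
`0` for `|x| ≥ 1`). -/
noncomputable def getoorFun (d : ℕ) (s : ℝ) (x : EuclideanSpace ℝ (Fin d)) : ℝ :=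
  if ‖x‖ < 1 then (1 - ‖x‖ ^ 2) ^ s else 0

open Filter Topology

lemma integrableOn_and_integral_beta {s : ℝ} (hs : s ∈ Ioo (0 : ℝ) 1) :
    IntegrableOn (fun x : ℝ => x ^ (s - 1) * (1 - x) ^ (-s)) (Ioo 0 1) ∧
      ∫ x in Ioo (0 : ℝ) 1, x ^ (s - 1) * (1 - x) ^ (-s) =
        Real.Gamma s * Real.Gamma (1 - s) := by
  have hconv := Complex.betaIntegral_convergent (u := (s : ℂ)) (v := ((1 - s : ℝ) : ℂ))
    (by simpa using hs.1) (by simpa using hs.2)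
  have hval := Complex.Gamma_mul_Gamma_eq_betaIntegral (s := (s : ℂ)) (t := ((1 - s : ℝ) : ℂ))
    (by simpa using hs.1) (by simpa using hs.2)
  rw [intervalIntegrable_iff_integrableOn_Ioo_of_le zero_le_one] at hconv
  have hcast : EqOn (fun x : ℝ => (x : ℂ) ^ ((s : ℂ) - 1) * (1 - (x : ℂ)) ^ (((1 - s : ℝ) : ℂ) - 1))
      (fun x : ℝ => ((x ^ (s - 1) * (1 - x) ^ (-s) : ℝ) : ℂ)) (Ioo 0 1) := by
    intro x hx
    have h1 : 0 ≤ x := hx.1.le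
    have h2 : 0 ≤ 1 - x := by linarith [hx.2]
    simp only [Complex.ofReal_mul, Complex.ofReal_cpow h1, Complex.ofReal_cpow h2]
    push_cast
    ring_nf
  have hint : IntegrableOn (fun x : ℝ => x ^ (s - 1) * (1 - x) ^ (-s)) (Ioo 0 1) := by
    exact Integrable.re (hconv.congr_fun hcast measurableSet_Ioo)
  refine ⟨hint, ?_⟩
  rw [Complex.betaIntegral, intervalIntegral.integral_of_le zero_le_one,
    integral_Ioc_eq_integral_Ioo, setIntegral_congr_fun measurableSet_Ioo hcast,
    integral_complex_ofReal, Complex.Gamma_ofReal, Complex.Gamma_ofReal, ← Complex.ofReal_add,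
    Complex.Gamma_ofReal, add_sub_cancel, Real.Gamma_one] at hval
  norm_cast at hval
  rw [hval, one_mul]

lemma integrableOn_and_integral_rpow_div_one_add {s : ℝ} (hs : s ∈ Ioo (0 : ℝ) 1) :
    IntegrableOn (fun p : ℝ => p ^ (s - 1) / (1 + p)) (Ioi 0) ∧
      ∫ p in Ioi (0 : ℝ), p ^ (s - 1) / (1 + p) = Real.Gamma s * Real.Gamma (1 - s) := by
  have himg : (fun p : ℝ => p / (1 + p)) '' Ioi 0 = Ioo 0 1 := by
    ext x
    constructor
    · rintro ⟨p, hp, rfl⟩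
      have hp : 0 < p := hp
      exact ⟨by positivity, (div_lt_one (by positivity)).2 (by linarith)⟩
    · rintro ⟨h0, h1⟩
      have : 0 < 1 - x := by linarith
      refine ⟨x / (1 - x), div_pos h0 this, ?_⟩
      simp only
      field_simp
      ring
  have hinj : InjOn (fun p : ℝ => p / (1 + p)) (Ioi 0) := by
    intro p hp q hq h
    have hp : 0 < p := hp
    have hq : 0 < q := hq
    have h : p / (1 + p) = q / (1 + q) := h
    field_simp at h
    linarith
  have hderiv : ∀ p ∈ Ioi (0 : ℝ),
      HasDerivWithinAt (fun p : ℝ => p / (1 + p)) (1 / (1 + p) ^ 2) (Ioi 0) p := by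
    intro p hp
    have hp : 0 < p := hp
    have := (hasDerivAt_id p).div ((hasDerivAt_id p).const_add 1) (by simp; positivity)
    have e : 1 / (1 + p) ^ 2 = (1 * (1 + id p) - id p * 1) / (1 + id p) ^ 2 := by simp
    rw [e]
    exact this.hasDerivWithinAt
  have heq : EqOn (fun p : ℝ => |1 / (1 + p) ^ 2| •
      ((p / (1 + p)) ^ (s - 1) * (1 - p / (1 + p)) ^ (-s)))
      (fun p : ℝ => p ^ (s - 1) / (1 + p)) (Ioi 0) := by
    intro p hp
    have hp : 0 < p := hp
    have hq : 0 < 1 + p := by positivity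
    have h1 : 1 - p / (1 + p) = (1 + p)⁻¹ := by field_simp; ring
    simp only [h1, smul_eq_mul]
    rw [abs_of_pos (by positivity), div_rpow hp.le hq.le, inv_rpow hq.le, rpow_neg hq.le, inv_inv,
      rpow_sub_one hq.ne']
    field_simp
  obtain ⟨hi, hv⟩ := integrableOn_and_integral_beta hs
  rw [← himg] at hi hv
  rw [integrableOn_image_iff_integrableOn_abs_deriv_smul measurableSet_Ioi hderiv hinj,
    integrableOn_congr_fun heq measurableSet_Ioi] at hi
  rw [integral_image_eq_integral_abs_deriv_smul measurableSet_Ioi hderiv hinj,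
    setIntegral_congr_fun measurableSet_Ioi heq] at hv
  exact ⟨hi, hv⟩

lemma continuous_div_sub_of_eventually_zero {f : ℝ → ℝ} {a : ℝ} (hf : Continuous f)
    (hz : ∀ᶠ v in 𝓝 a, f v = 0) : Continuous fun v => f v / (v - a) := by
  rw [continuous_iff_continuousAt]
  intro v
  by_cases hv : v = a
  · subst hv
    refine (continuousAt_const (y := (0 : ℝ))).congr ?_
    filter_upwards [hz] with w hw
    simp [hw]
  · exact hf.continuousAt.div (by fun_prop) (sub_ne_zero.2 hv)

lemma integral_shift_add_shift {f : ℝ → ℝ} {h : ℝ} (hf : Continuous f)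
    (hz : ∀ᶠ v in 𝓝 h, f v = 0) (hz' : ∀ᶠ v in 𝓝 (-h), f v = 0)
    (h0 : ∀ v, |v| ≤ |h| → f v = 0) (N : ℝ) :
    (∫ w in (0 : ℝ)..N, f (w - h) / w) + (∫ w in (0 : ℝ)..N, f (w + h) / w) =
      (∫ v in (0 : ℝ)..N, (f v / (v + h) + f v / (v - h))) +
        ∫ v in N..(N + h), (f v / (v - h) - f (v - h) / v) := by
  have c1 : Continuous fun v => f v / (v - h) := continuous_div_sub_of_eventually_zero hf hz
  have c2 : Continuous fun v => f v / (v + h) := by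
    simpa using continuous_div_sub_of_eventually_zero hf hz'
  have c3 : Continuous fun v => f (v - h) / v := by
    simpa [Function.comp_def] using
      c2.comp (by fun_prop : Continuous fun v : ℝ => v - h)
  have e1 : ∫ w in (0 : ℝ)..N, f (w - h) / w = ∫ v in (-h)..(N - h), f v / (v + h) := by
    have := intervalIntegral.integral_comp_sub_right (a := 0) (b := N) (fun v => f v / (v + h)) h
    simpa using this
  have e2 : ∫ w in (0 : ℝ)..N, f (w + h) / w = ∫ v in h..(N + h), f v / (v - h) := by
    have := intervalIntegral.integral_comp_add_right (a := 0) (b := N) (fun v => f v / (v - h)) h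
    simpa using this
  have e3 : ∫ v in N..(N + h), f (v - h) / v = ∫ v in (N - h)..N, f v / (v + h) := by
    have := intervalIntegral.integral_comp_sub_right (a := N) (b := N + h)
      (fun v => f v / (v + h)) h
    simpa using this
  have z1 : ∫ v in (-h)..(0 : ℝ), f v / (v + h) = 0 := by
    rw [intervalIntegral.integral_congr (g := fun _ => (0 : ℝ))]
    · simp
    · intro v hv
      have : |v| ≤ |h| := by
        have := abs_sub_left_of_mem_uIcc (uIcc_comm (-h) 0 ▸ hv)
        simpa using this
      simp [h0 v this]
  have z2 : ∫ v in h..(0 : ℝ), f v / (v - h) = 0 := by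
    rw [intervalIntegral.integral_congr (g := fun _ => (0 : ℝ))]
    · simp
    · intro v hv
      have : |v| ≤ |h| := by
        have := abs_sub_left_of_mem_uIcc (uIcc_comm h 0 ▸ hv)
        simpa using this
      simp [h0 v this]
  have i1 := fun a b => c1.intervalIntegrable (μ := volume) a b
  have i2 := fun a b => c2.intervalIntegrable (μ := volume) a b
  have i3 := fun a b => c3.intervalIntegrable (μ := volume) a b
  rw [intervalIntegral.integral_add (i2 _ _) (i1 _ _),
    intervalIntegral.integral_sub (i1 _ _) (i3 _ _), e1, e2, e3]
  have a1 := intervalIntegral.integral_add_adjacent_intervals (i2 (-h) 0) (i2 0 (N - h))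
  have a2 := intervalIntegral.integral_add_adjacent_intervals (i1 h 0) (i1 0 (N + h))
  have a3 := intervalIntegral.integral_add_adjacent_intervals (i2 0 (N - h)) (i2 (N - h) N)
  have a4 := intervalIntegral.integral_add_adjacent_intervals (i1 0 N) (i1 N (N + h))
  linarith

lemma tendsto_intervalIntegral_of_tendsto_zero {φ : ℝ → ℝ} (hφ : Tendsto φ atTop (𝓝 0)) (h : ℝ) :
    Tendsto (fun N => ∫ v in N..(N + h), φ v) atTop (𝓝 0) := by
  rw [Metric.tendsto_nhds]
  intro ε hε
  obtain ⟨M, hM⟩ := eventually_atTop.1 ((Metric.tendsto_nhds.1 hφ) (ε / (|h| + 1)) (by positivity))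
  filter_upwards [eventually_ge_atTop (M + |h|)] with N hN
  have hb : ‖∫ v in N..(N + h), φ v‖ ≤ ε / (|h| + 1) * |N + h - N| := by
    refine intervalIntegral.norm_integral_le_of_norm_le_const fun v hv => ?_
    have hv' := uIoc_subset_uIcc hv
    have : M ≤ v := by
      have h1 : min N (N + h) ≤ v := hv'.1
      have h2 : M ≤ min N (N + h) :=
        le_min (by linarith [abs_nonneg h]) (by linarith [neg_abs_le h])
      exact h2.trans h1
    simpa using (hM v this).le
  rw [dist_zero_right]
  refine hb.trans_lt ?_
  rw [add_sub_cancel_left, div_mul_eq_mul_div, div_lt_iff₀ (by positivity)]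
  nlinarith [abs_nonneg h]

lemma tendsto_rpow_mul_sub_inv {g : ℝ → ℝ} {l t : ℝ} (hg : DifferentiableAt ℝ g 0) (h0 : g 0 = l)
    (ht : t < 1) : Tendsto (fun v : ℝ => v ^ t * (g v⁻¹ - l)) atTop (𝓝 0) := by
  have h1 : (fun v : ℝ => g v⁻¹ - l) =O[atTop] fun v : ℝ => v⁻¹ := by
    have := hg.isBigO_sub.comp_tendsto tendsto_inv_atTop_zero
    simpa [Function.comp_def, h0] using this
  have h2 := (Asymptotics.isBigO_refl (fun v : ℝ => v ^ t) atTop).mul h1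
  refine h2.trans_tendsto ?_
  have h3 : Tendsto (fun v : ℝ => v ^ (-(1 - t))) atTop (𝓝 0) :=
    tendsto_rpow_neg_atTop (by linarith)
  refine h3.congr' ?_
  filter_upwards [eventually_gt_atTop 0] with v hv
  rw [neg_sub, rpow_sub_one hv.ne', div_eq_mul_inv]

lemma tendsto_bracket_remainder {c h s : ℝ} (hc : 0 < c) (hs : s ∈ Ioo (0 : ℝ) 1) :
    Tendsto (fun v : ℝ => max (c * (v ^ 2 - h ^ 2) - 1) 0 ^ s / (v - h) -
      max (c * ((v - h) ^ 2 - h ^ 2) - 1) 0 ^ s / v) atTop (𝓝 0) := by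
  set g : ℝ → ℝ := fun y => (c * (1 - h ^ 2 * y ^ 2) - y ^ 2) ^ s / (1 - h * y) -
    (c * ((1 - h * y) ^ 2 - h ^ 2 * y ^ 2) - y ^ 2) ^ s with hg
  have g0 : g 0 = 0 := by simp [hg]
  have gd : DifferentiableAt ℝ g 0 := by
    refine DifferentiableAt.sub (DifferentiableAt.div ?_ (by fun_prop) (by simp)) ?_
    · exact DifferentiableAt.rpow_const (by fun_prop) (Or.inl (by simpa using hc.ne'))
    · exact DifferentiableAt.rpow_const (by fun_prop) (Or.inl (by simpa using hc.ne'))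
  have hlim := tendsto_rpow_mul_sub_inv (t := 2 * s - 1) gd g0 (by linarith [hs.2])
  have p1 : ∀ᶠ v : ℝ in atTop, 0 < c * (1 - h ^ 2 * v⁻¹ ^ 2) - v⁻¹ ^ 2 := by
    have hcont : ContinuousAt (fun y : ℝ => c * (1 - h ^ 2 * y ^ 2) - y ^ 2) 0 := by fun_prop
    exact (hcont.tendsto.comp tendsto_inv_atTop_zero).eventually_const_lt (by simpa using hc)
  have p2 : ∀ᶠ v : ℝ in atTop, 0 < c * ((1 - h * v⁻¹) ^ 2 - h ^ 2 * v⁻¹ ^ 2) - v⁻¹ ^ 2 := by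
    have hcont : ContinuousAt
      (fun y : ℝ => c * ((1 - h * y) ^ 2 - h ^ 2 * y ^ 2) - y ^ 2) 0 := by fun_prop
    exact (hcont.tendsto.comp tendsto_inv_atTop_zero).eventually_const_lt (by simpa using hc)
  refine hlim.congr' ?_
  filter_upwards [p1, p2, eventually_gt_atTop 0, eventually_gt_atTop h] with v hp1 hp2 hv hvh
  have e1 : c * (v ^ 2 - h ^ 2) - 1 = v ^ 2 * (c * (1 - h ^ 2 * v⁻¹ ^ 2) - v⁻¹ ^ 2) := by
    field_simp
  have e2 : c * ((v - h) ^ 2 - h ^ 2) - 1 =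
      v ^ 2 * (c * ((1 - h * v⁻¹) ^ 2 - h ^ 2 * v⁻¹ ^ 2) - v⁻¹ ^ 2) := by
    field_simp
  have e3 : v - h = v * (1 - h * v⁻¹) := by field_simp
  have e4 : (v ^ 2) ^ s = v ^ (2 * s) := by
    rw [← rpow_natCast, ← rpow_mul hv.le]; norm_num
  have hv1 : 1 - h * v⁻¹ ≠ 0 := by
    intro h0
    rw [h0] at e3
    linarith
  rw [e1, e2, max_eq_left (by positivity), max_eq_left (by positivity),
    mul_rpow (by positivity) hp1.le, mul_rpow (by positivity) hp2.le, e4, rpow_sub_one hv.ne', hg]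
  rw [e3]
  simp only [sub_zero]
  field_simp

lemma integral_bracket_symm {c h s N : ℝ} (hc : 0 < c) (hs : s ∈ Ioo (0 : ℝ) 1)
    (hN : 0 < c * (N ^ 2 - h ^ 2) - 1) :
    ∫ v in (0 : ℝ)..N, (max (c * (v ^ 2 - h ^ 2) - 1) 0 ^ s / (v + h) +
        max (c * (v ^ 2 - h ^ 2) - 1) 0 ^ s / (v - h)) =
      (c * (N ^ 2 - h ^ 2) - 1) ^ s / s -
        ∫ p in (0 : ℝ)..(c * (N ^ 2 - h ^ 2) - 1), p ^ (s - 1) / (1 + p) := by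
  set X := c * (N ^ 2 - h ^ 2) - 1 with hX
  have hs0 : s ≠ 0 := hs.1.ne'
  have hfc : Continuous fun p : ℝ => max p 0 ^ s / (p + 1) := by
    have hf : Continuous fun p : ℝ => max p 0 ^ s :=
      (continuous_id.max continuous_const).rpow_const fun _ => Or.inr hs.1.le
    have := continuous_div_sub_of_eventually_zero (a := -1) hf (by
      filter_upwards [eventually_lt_nhds (show (-1 : ℝ) < 0 by norm_num)] with p hp
      rw [max_eq_right hp.le, zero_rpow hs0])
    simpa using this
  have hderiv : ∀ v ∈ uIcc 0 N,
      HasDerivAt (fun v : ℝ => c * (v ^ 2 - h ^ 2) - 1) (c * (2 * v)) v := by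
    intro v _
    have := (((hasDerivAt_pow 2 v).sub_const (h ^ 2)).const_mul c).sub_const 1
    simpa using this
  have hsub := intervalIntegral.integral_comp_mul_deriv hderiv (by fun_prop) hfc
  have hleft : ∫ v in (0 : ℝ)..N, (max (c * (v ^ 2 - h ^ 2) - 1) 0 ^ s / (v + h) +
        max (c * (v ^ 2 - h ^ 2) - 1) 0 ^ s / (v - h)) =
      ∫ p in (c * ((0 : ℝ) ^ 2 - h ^ 2) - 1)..X, max p 0 ^ s / (p + 1) := by
    rw [hX, ← hsub]
    refine intervalIntegral.integral_congr fun v _ => ?_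
    simp only [Function.comp]
    rcases le_or_gt (c * (v ^ 2 - h ^ 2) - 1) 0 with hle | hgt
    · simp [max_eq_right hle, zero_rpow hs0]
    · have hvh : (v + h) * (v - h) ≠ 0 := by
        intro h0
        have : v ^ 2 - h ^ 2 = 0 := by linarith [h0, show (v + h) * (v - h) = v ^ 2 - h ^ 2 by ring]
        rw [this] at hgt
        linarith
      have h1 : v + h ≠ 0 := left_ne_zero_of_mul hvh
      have h2 : v - h ≠ 0 := right_ne_zero_of_mul hvh
      have h3 : c * (v ^ 2 - h ^ 2) - 1 + 1 = c * ((v + h) * (v - h)) := by ring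
      rw [h3]
      field_simp
      ring
  have hneg : ∫ p in (c * ((0 : ℝ) ^ 2 - h ^ 2) - 1)..0, max p 0 ^ s / (p + 1) = 0 := by
    rw [intervalIntegral.integral_congr (g := fun _ => (0 : ℝ))]
    · simp
    · intro p hp
      have h0 : c * ((0 : ℝ) ^ 2 - h ^ 2) - 1 ≤ 0 := by nlinarith [sq_nonneg h]
      rw [uIcc_of_le h0] at hp
      simp [max_eq_right hp.2, zero_rpow hs0]
  have hint := fun a b => hfc.intervalIntegrable (μ := volume) a b
  rw [hleft, ← intervalIntegral.integral_add_adjacent_intervals (hint _ 0) (hint 0 _), hneg,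
    zero_add]
  have hpow : IntervalIntegrable (fun p : ℝ => p ^ (s - 1)) volume 0 X :=
    intervalIntegral.intervalIntegrable_rpow' (by linarith [hs.1])
  have hI : IntervalIntegrable (fun p : ℝ => p ^ (s - 1) / (1 + p)) volume 0 X := by
    rw [intervalIntegrable_iff_integrableOn_Ioc_of_le hN.le]
    exact (integrableOn_and_integral_rpow_div_one_add hs).1.mono_set Ioc_subset_Ioi_self
  have hX1 : X ^ s / s = ∫ p in (0 : ℝ)..X, p ^ (s - 1) := by
    rw [integral_rpow (Or.inl (by linarith [hs.1]))]
    simp [zero_rpow hs0]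
  rw [hX1, ← intervalIntegral.integral_sub hpow hI]
  refine intervalIntegral.integral_congr_ae (Eventually.of_forall fun p hp => ?_)
  rw [uIoc_of_le hN.le] at hp
  have hp0 : 0 < p := hp.1
  rw [max_eq_left hp0.le, rpow_sub_one hp0.ne']
  field_simp
  ring

lemma tendsto_rpow_sub_bracket {c h s : ℝ} (hc : 0 < c) (hs : s ∈ Ioo (0 : ℝ) 1) :
    Tendsto (fun N : ℝ => c ^ s * N ^ (2 * s) - (c * (N ^ 2 - h ^ 2) - 1) ^ s) atTop (𝓝 0) := by
  set g : ℝ → ℝ := fun y => (c - (c * h ^ 2 + 1) * y) ^ s with hg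
  have g0 : g 0 = c ^ s := by simp [hg]
  have gd : DifferentiableAt ℝ g 0 :=
    DifferentiableAt.rpow_const (by fun_prop) (Or.inl (by simpa using hc.ne'))
  have hsq : Tendsto (fun N : ℝ => N ^ 2) atTop atTop := tendsto_pow_atTop two_ne_zero
  have hlim := ((tendsto_rpow_mul_sub_inv gd g0 hs.2).comp hsq).neg
  have p1 : ∀ᶠ v : ℝ in atTop, 0 < c - (c * h ^ 2 + 1) * (v ^ 2)⁻¹ := by
    have hcont : ContinuousAt (fun y : ℝ => c - (c * h ^ 2 + 1) * y) 0 := by fun_prop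
    exact (hcont.tendsto.comp (tendsto_inv_atTop_zero.comp hsq)).eventually_const_lt
      (by simpa using hc)
  rw [neg_zero] at hlim
  refine hlim.congr' ?_
  filter_upwards [p1, eventually_gt_atTop 0] with v hp hv
  have e1 : c * (v ^ 2 - h ^ 2) - 1 = v ^ 2 * (c - (c * h ^ 2 + 1) * (v ^ 2)⁻¹) := by
    field_simp
    ring
  have e4 : (v ^ 2) ^ s = v ^ (2 * s) := by
    rw [← rpow_natCast, ← rpow_mul hv.le]; norm_num
  rw [e1, mul_rpow (by positivity) hp.le]
  simp only [Function.comp, hg, e4]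
  ring

lemma integral_inverted_secondDiff {c h s : ℝ} (hc : 0 < c) (hs : s ∈ Ioo (0 : ℝ) 1)
    (hint : IntegrableOn (fun w : ℝ => (2 * (c ^ s * w ^ (2 * s)) -
      max (c * ((w - h) ^ 2 - h ^ 2) - 1) 0 ^ s -
      max (c * ((w + h) ^ 2 - h ^ 2) - 1) 0 ^ s) / w) (Ioi 0)) :
    ∫ w in Ioi (0 : ℝ), (2 * (c ^ s * w ^ (2 * s)) -
      max (c * ((w - h) ^ 2 - h ^ 2) - 1) 0 ^ s -
      max (c * ((w + h) ^ 2 - h ^ 2) - 1) 0 ^ s) / w = Real.Gamma s * Real.Gamma (1 - s) := by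
  have hs0 : s ≠ 0 := hs.1.ne'
  set Q : ℝ → ℝ := fun v => max (c * (v ^ 2 - h ^ 2) - 1) 0 ^ s with hQ
  have hQc : Continuous Q :=
    Continuous.rpow_const (by fun_prop) fun _ => Or.inr hs.1.le
  have hQ0 : ∀ v, c * (v ^ 2 - h ^ 2) - 1 ≤ 0 → Q v = 0 := fun v hv => by
    simp [hQ, max_eq_right hv, zero_rpow hs0]
  have hQsmall : ∀ v, |v| ≤ |h| → Q v = 0 := fun v hv => hQ0 v (by
    nlinarith [sq_le_sq.2 hv])
  have hQnear : ∀ a, a ^ 2 = h ^ 2 → ∀ᶠ v in 𝓝 a, Q v = 0 := fun a ha => by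
    have hcont : ContinuousAt (fun v : ℝ => c * (v ^ 2 - h ^ 2) - 1) a := by fun_prop
    filter_upwards [hcont.tendsto.eventually_lt_const (show _ < (0 : ℝ) by simp [ha])] with v hv
    exact hQ0 v hv.le
  have c1 : Continuous fun v => Q (v - h) / v := by
    have := continuous_div_sub_of_eventually_zero hQc (hQnear (-h) (by ring))
    simpa [Function.comp_def] using this.comp (by fun_prop : Continuous fun v : ℝ => v - h)
  have c2 : Continuous fun v => Q (v + h) / v := by
    have := continuous_div_sub_of_eventually_zero hQc (hQnear h rfl)
    simpa [Function.comp_def] using this.comp (by fun_prop : Continuous fun v : ℝ => v + h)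
  have hlim1 := intervalIntegral_tendsto_integral_Ioi 0 hint tendsto_id
  have hXlim : Tendsto (fun N : ℝ => c * (N ^ 2 - h ^ 2) - 1) atTop atTop :=
    tendsto_atTop_add_const_right _ _ ((tendsto_atTop_add_const_right _ _
      (tendsto_pow_atTop two_ne_zero)).const_mul_atTop hc)
  obtain ⟨hmi, hmv⟩ := integrableOn_and_integral_rpow_div_one_add hs
  have hlim2 := intervalIntegral_tendsto_integral_Ioi 0 hmi hXlim
  rw [hmv] at hlim2
  have hlim3 := (((tendsto_rpow_sub_bracket (h := h) hc hs).div_const s).add hlim2).sub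
    (tendsto_intervalIntegral_of_tendsto_zero (tendsto_bracket_remainder (h := h) hc hs) h)
  rw [zero_div, zero_add, sub_zero] at hlim3
  refine tendsto_nhds_unique hlim1 (hlim3.congr' ?_)
  filter_upwards [hXlim.eventually_gt_atTop 0, eventually_gt_atTop 0] with N hX hN
  have hpow : IntervalIntegrable (fun w : ℝ => 2 * c ^ s * w ^ (2 * s - 1)) volume 0 N :=
    (intervalIntegral.intervalIntegrable_rpow' (by linarith [hs.1])).const_mul _
  have hpowv : ∫ w in (0 : ℝ)..N, 2 * c ^ s * w ^ (2 * s - 1) = c ^ s * N ^ (2 * s) / s := by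
    rw [intervalIntegral.integral_const_mul, integral_rpow (Or.inl (by linarith [hs.1]))]
    rw [sub_add_cancel, zero_rpow (by simpa using hs0)]
    field_simp
    ring
  have hsplit : ∫ w in (0 : ℝ)..N, (2 * (c ^ s * w ^ (2 * s)) - Q (w - h) - Q (w + h)) / w =
      ∫ w in (0 : ℝ)..N, (2 * c ^ s * w ^ (2 * s - 1) - Q (w - h) / w - Q (w + h) / w) := by
    refine intervalIntegral.integral_congr_ae (Eventually.of_forall fun w hw => ?_)
    rw [uIoc_of_le hN.le] at hw
    rw [rpow_sub_one hw.1.ne']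
    ring
  have i1 := c1.intervalIntegrable (μ := volume) 0 N
  have i2 := c2.intervalIntegrable (μ := volume) 0 N
  have hshift := integral_shift_add_shift hQc (hQnear h rfl) (hQnear (-h) (by ring)) hQsmall N
  have hsymm := integral_bracket_symm hc hs hX
  change _ = ∫ w in (0 : ℝ)..N, (2 * (c ^ s * w ^ (2 * s)) - Q (w - h) - Q (w + h)) / w
  rw [hsplit, intervalIntegral.integral_sub (hpow.sub i1) i2,
    intervalIntegral.integral_sub hpow i1, hpowv, sub_div]
  linarith

lemma integral_secondDiff {c b s : ℝ} (hc : 0 < c) (hs : s ∈ Ioo (0 : ℝ) 1)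
    (hint : IntegrableOn (fun r : ℝ => (2 * c ^ s - max (c - 2 * b * r - r ^ 2) 0 ^ s -
      max (c + 2 * b * r - r ^ 2) 0 ^ s) * r ^ (-1 - 2 * s)) (Ioi 0)) :
    ∫ r in Ioi (0 : ℝ), (2 * c ^ s - max (c - 2 * b * r - r ^ 2) 0 ^ s -
      max (c + 2 * b * r - r ^ 2) 0 ^ s) * r ^ (-1 - 2 * s) =
        Real.Gamma s * Real.Gamma (1 - s) := by
  have heq : EqOn (fun w : ℝ => (|(-1 : ℝ)| * w ^ ((-1 : ℝ) - 1)) •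
      ((2 * c ^ s - max (c - 2 * b * w ^ (-1 : ℝ) - (w ^ (-1 : ℝ)) ^ 2) 0 ^ s -
      max (c + 2 * b * w ^ (-1 : ℝ) - (w ^ (-1 : ℝ)) ^ 2) 0 ^ s) *
        (w ^ (-1 : ℝ)) ^ (-1 - 2 * s)))
      (fun w : ℝ => (2 * (c ^ s * w ^ (2 * s)) -
        max (c * ((w - b / c) ^ 2 - (b / c) ^ 2) - 1) 0 ^ s -
        max (c * ((w + b / c) ^ 2 - (b / c) ^ 2) - 1) 0 ^ s) / w) (Ioi 0) := by
    intro w hw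
    have hw : 0 < w := hw
    have e4 : w ^ (2 * s) = (w ^ 2) ^ s := by
      rw [← rpow_natCast, ← rpow_mul hw.le]; norm_num
    have key : ∀ x : ℝ, w ^ (2 * s) * max x 0 ^ s = max (w ^ 2 * x) 0 ^ s := fun x => by
      rw [e4, ← mul_rpow (by positivity) (le_max_right _ _), mul_max_of_nonneg _ _ (by positivity),
        mul_zero]
    have e1 : c * ((w - b / c) ^ 2 - (b / c) ^ 2) - 1 =
        w ^ 2 * (c - 2 * b * w⁻¹ - w⁻¹ ^ 2) := by
      field_simp
      ring
    have e2 : c * ((w + b / c) ^ 2 - (b / c) ^ 2) - 1 =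
        w ^ 2 * (c + 2 * b * w⁻¹ - w⁻¹ ^ 2) := by
      field_simp
      ring
    have e3 : w ^ ((-1 : ℝ) - 1) * w⁻¹ ^ (-1 - 2 * s) = w ^ (2 * s) / w := by
      rw [inv_rpow hw.le, ← rpow_neg hw.le, ← rpow_add hw, ← rpow_sub_one hw.ne']
      ring_nf
    simp only [rpow_neg_one, abs_neg, abs_one, one_mul, smul_eq_mul]
    rw [e1, e2, ← key, ← key]
    calc _ = (2 * c ^ s - max (c - 2 * b * w⁻¹ - w⁻¹ ^ 2) 0 ^ s -
          max (c + 2 * b * w⁻¹ - w⁻¹ ^ 2) 0 ^ s) *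
            (w ^ ((-1 : ℝ) - 1) * w⁻¹ ^ (-1 - 2 * s)) := by ring
      _ = _ := by rw [e3]; ring
  have hne : (-1 : ℝ) ≠ 0 := by norm_num
  rw [← integrableOn_Ioi_comp_rpow_iff _ hne, integrableOn_congr_fun heq measurableSet_Ioi] at hint
  rw [← integral_comp_rpow_Ioi _ hne, setIntegral_congr_fun measurableSet_Ioi heq]
  exact integral_inverted_secondDiff hc hs hint

lemma abs_posPart_rpow_sub_affine_le {s : ℝ} (hs : s ∈ Ioo (0 : ℝ) 1) (z : ℝ) :
    |max (1 + z) 0 ^ s - (1 + s * z)| ≤ z ^ 2 := by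
  obtain ⟨hs0, hs1⟩ := hs
  rcases le_or_gt (1 + z) 0 with hz | hz
  · rw [max_eq_right hz, zero_rpow hs0.ne', abs_le]
    constructor <;> nlinarith [mul_nonneg hs0.le (by linarith : 0 ≤ -1 - z),
      mul_nonneg (by linarith : 0 ≤ 1 - s) (by linarith : 0 ≤ -z)]
  · rw [max_eq_left hz.le]
    have hup : (1 + z) ^ s ≤ 1 + s * z :=
      rpow_one_add_le_one_add_mul_self (by linarith) hs0.le hs1.le
    have hup' : (1 + z) ^ (1 - s) ≤ 1 + (1 - s) * z :=
      rpow_one_add_le_one_add_mul_self (by linarith) (by linarith) (by linarith)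
    have hprod : (1 + z) ^ s * (1 + z) ^ (1 - s) = 1 + z := by
      rw [← rpow_add hz, add_sub_cancel, rpow_one]
    have hpos : 0 < (1 + z) ^ s := rpow_pos_of_pos hz _
    have hden : 0 < 1 + (1 - s) * z := by nlinarith
    have hge : 1 + z ≤ (1 + z) ^ s * (1 + (1 - s) * z) := by
      nlinarith [mul_le_mul_of_nonneg_left hup' hpos.le]
    have hlow : (1 + s * z - z ^ 2) * (1 + (1 - s) * z) ≤ 1 + z := by
      nlinarith [mul_nonneg (sq_nonneg z) (sq_nonneg s),
        mul_nonneg (sq_nonneg z) (mul_nonneg (by linarith : 0 ≤ 1 - s) hz.le)]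
    have := le_of_mul_le_mul_right (hlow.trans hge) hden
    rw [abs_le]
    constructor <;> nlinarith [sq_nonneg z]

lemma exists_secondDiff_bound {c s : ℝ} (hc : 0 < c) (hs : s ∈ Ioo (0 : ℝ) 1) :
    ∃ K, 0 ≤ K ∧ ∀ b r : ℝ, |b| ≤ 1 → 0 ≤ r →
      |2 * c ^ s - max (c - 2 * b * r - r ^ 2) 0 ^ s - max (c + 2 * b * r - r ^ 2) 0 ^ s| ≤
        K * min 1 (r ^ 2) := by
  have hcs : 0 < c ^ s := rpow_pos_of_pos hc s
  have hcs1 : 0 < (c + 1) ^ s := by positivity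
  refine ⟨2 * c ^ s + 2 * (c + 1) ^ s + c ^ s * (2 / c + 18 / c ^ 2), by positivity, ?_⟩
  intro b r hb hr
  have hb2 : b ^ 2 ≤ 1 := by simpa using sq_le_one_iff_abs_le_one b |>.2 hb
  rcases le_total r 1 with hr1 | hr1
  · rw [min_eq_right (by nlinarith)]
    have scale : ∀ x, max x 0 ^ s = c ^ s * max (1 + (x / c - 1)) 0 ^ s := fun x => by
      rw [← mul_rpow hc.le (le_max_right _ _), mul_max_of_nonneg _ _ hc.le, mul_zero]
      congr 2
      field_simp
      ring
    have zbound : ∀ β : ℝ, |β| ≤ 1 → ((c + 2 * β * r - r ^ 2) / c - 1) ^ 2 ≤ 9 / c ^ 2 * r ^ 2 := by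
      intro β hβ
      have e : (c + 2 * β * r - r ^ 2) / c - 1 = r * (2 * β - r) / c := by
        field_simp
        ring
      have : (2 * β - r) ^ 2 ≤ 9 := by
        have := abs_le.1 hβ
        nlinarith
      rw [e, div_pow, mul_pow, div_mul_eq_mul_div]
      exact div_le_div_of_nonneg_right (by nlinarith [sq_nonneg r]) (by positivity)
    have k1 := (abs_posPart_rpow_sub_affine_le hs ((c + 2 * (-b) * r - r ^ 2) / c - 1)).trans
      (zbound (-b) (by simpa using hb))
    have k2 := (abs_posPart_rpow_sub_affine_le hs ((c + 2 * b * r - r ^ 2) / c - 1)).trans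
      (zbound b hb)
    have e1 : c - 2 * b * r - r ^ 2 = c + 2 * (-b) * r - r ^ 2 := by ring
    rw [e1, scale, scale (c + 2 * b * r - r ^ 2)]
    set A := max (1 + ((c + 2 * (-b) * r - r ^ 2) / c - 1)) 0 ^ s
    set B := max (1 + ((c + 2 * b * r - r ^ 2) / c - 1)) 0 ^ s
    have hz : s * ((c + 2 * (-b) * r - r ^ 2) / c - 1) + s * ((c + 2 * b * r - r ^ 2) / c - 1) =
        -(s * (2 / c * r ^ 2)) := by
      field_simp
      ring
    have hpos : 0 ≤ 2 / c * r ^ 2 := by positivity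
    have hs2 : s * (2 / c * r ^ 2) ≤ 2 / c * r ^ 2 := by nlinarith [hs.2]
    have hs3 : 0 ≤ s * (2 / c * r ^ 2) := mul_nonneg hs.1.le hpos
    have hmain : |2 - A - B| ≤ (2 / c + 18 / c ^ 2) * r ^ 2 := by
      rw [abs_le] at k1 k2 ⊢
      have e18 : 18 / c ^ 2 * r ^ 2 = 9 / c ^ 2 * r ^ 2 + 9 / c ^ 2 * r ^ 2 := by ring
      constructor <;> linarith [k1.1, k1.2, k2.1, k2.2]
    have e2 : 2 * c ^ s - c ^ s * A - c ^ s * B = c ^ s * (2 - A - B) := by ring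
    rw [e2, abs_mul, abs_of_pos hcs]
    have : 0 ≤ (2 * c ^ s + 2 * (c + 1) ^ s) * r ^ 2 := by positivity
    nlinarith [mul_le_mul_of_nonneg_left hmain hcs.le]
  · rw [min_eq_left (by nlinarith), mul_one]
    have hA : max (c - 2 * b * r - r ^ 2) 0 ^ s ≤ (c + 1) ^ s :=
      rpow_le_rpow (le_max_right _ _)
        (max_le (by nlinarith [sq_nonneg (r + b)]) (by positivity)) hs.1.le
    have hB : max (c + 2 * b * r - r ^ 2) 0 ^ s ≤ (c + 1) ^ s :=
      rpow_le_rpow (le_max_right _ _)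
        (max_le (by nlinarith [sq_nonneg (r - b)]) (by positivity)) hs.1.le
    have hA0 : 0 ≤ max (c - 2 * b * r - r ^ 2) 0 ^ s := rpow_nonneg (le_max_right _ _) _
    have hB0 : 0 ≤ max (c + 2 * b * r - r ^ 2) 0 ^ s := rpow_nonneg (le_max_right _ _) _
    have : 0 ≤ c ^ s * (2 / c + 18 / c ^ 2) := by positivity
    rw [abs_le]
    constructor <;> linarith

lemma integrableOn_min_sq_mul_rpow {s : ℝ} (hs : s ∈ Ioo (0 : ℝ) 1) :
    IntegrableOn (fun r : ℝ => min 1 (r ^ 2) * r ^ (-1 - 2 * s)) (Ioi 0) := by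
  rw [← Ioc_union_Ioi_eq_Ioi (zero_le_one (α := ℝ)), integrableOn_union]
  constructor
  · have : IntegrableOn (fun r : ℝ => r ^ (1 - 2 * s)) (Ioc 0 1) := by
      rw [← intervalIntegrable_iff_integrableOn_Ioc_of_le zero_le_one]
      exact intervalIntegral.intervalIntegrable_rpow' (by linarith [hs.2])
    refine this.congr_fun (fun r hr => ?_) measurableSet_Ioc
    have hr0 : 0 < r := hr.1
    simp only
    rw [min_eq_right (by nlinarith [hr.2]), ← rpow_natCast, ← rpow_add hr0]
    congr 1
    push_cast
    ring
  · have : IntegrableOn (fun r : ℝ => r ^ (-1 - 2 * s)) (Ioi 1) :=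
      integrableOn_Ioi_rpow_of_lt (by linarith [hs.1]) one_pos
    refine this.congr_fun (fun r hr => ?_) measurableSet_Ioi
    have hr0 : 1 < r := hr
    simp only
    rw [min_eq_left (by nlinarith), one_mul]

lemma integral_eq_integral_toSphere_Ioi {E : Type*} [NormedAddCommGroup E] [NormedSpace ℝ E]
    [MeasurableSpace E] [BorelSpace E] [FiniteDimensional ℝ E] [Nontrivial E] (μ : Measure E)
    [μ.IsAddHaarMeasure] {f : E → ℝ} (hf : Integrable f μ) :
    ∫ x, f x ∂μ = ∫ θ : Metric.sphere (0 : E) 1,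
      (∫ r in Ioi (0 : ℝ), r ^ (Module.finrank ℝ E - 1) * f (r • (θ : E))) ∂μ.toSphere := by
  set n := Module.finrank ℝ E - 1 with hn
  set G : Metric.sphere (0 : E) 1 × Ioi (0 : ℝ) → ℝ := fun p => f (p.2.1 • p.1.1) with hG
  have hmp := μ.measurePreserving_homeomorphUnitSphereProd
  have hcomp : ∀ x : ({0}ᶜ : Set E), G (homeomorphUnitSphereProd E x) = f x := by
    intro x
    have hx : ‖(x : E)‖ ≠ 0 := norm_ne_zero_iff.2 x.2
    simp [hG, smul_smul, hx]
  have hint : Integrable G (μ.toSphere.prod (Measure.volumeIoiPow n)) := by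
    rw [← hmp.integrable_comp_emb (Homeomorph.measurableEmbedding _)]
    have : Integrable (f ∘ ((↑) : ({0}ᶜ : Set E) → E)) (μ.comap (↑)) := by
      rw [← integrableOn_iff_comap_subtypeVal (measurableSet_singleton _).compl]
      exact hf.integrableOn
    refine this.congr (Eventually.of_forall fun x => ?_)
    simp [hcomp]
  calc ∫ x, f x ∂μ = ∫ x : ({0}ᶜ : Set E), f x ∂(μ.comap (↑)) := by
        rw [integral_subtype_comap (measurableSet_singleton _).compl f, restrict_compl_singleton]
    _ = ∫ p, G p ∂μ.toSphere.prod (Measure.volumeIoiPow n) := by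
        rw [← hmp.integral_comp (Homeomorph.measurableEmbedding _)]
        simp [hcomp]
    _ = ∫ θ, ∫ r, G (θ, r) ∂(Measure.volumeIoiPow n) ∂μ.toSphere := integral_prod _ hint
    _ = _ := by
        refine integral_congr_ae (Eventually.of_forall fun θ => ?_)
        simp only [Measure.volumeIoiPow, ENNReal.ofReal, hG]
        rw [integral_withDensity_eq_integral_smul
            (measurable_subtype_coe.pow_const _).real_toNNReal,
          integral_subtype_comap measurableSet_Ioi
            fun a ↦ Real.toNNReal (a ^ n) • f (a • (θ : E)),
          setIntegral_congr_fun measurableSet_Ioi fun x hx ↦ ?_]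
        rw [NNReal.smul_def, Real.coe_toNNReal _ (pow_nonneg (le_of_lt hx) _), smul_eq_mul]

lemma toSphere_real_univ_euclideanSpace {d : ℕ} (hd : 1 ≤ d) :
    (volume : Measure (EuclideanSpace ℝ (Fin d))).toSphere.real univ =
      2 * π ^ ((d : ℝ) / 2) / Real.Gamma ((d : ℝ) / 2) := by
  have : Nonempty (Fin d) := ⟨⟨0, hd⟩⟩
  have hd0 : (0 : ℝ) < d := by exact_mod_cast hd
  have hG : 0 < Real.Gamma ((d : ℝ) / 2) := Real.Gamma_pos_of_pos (by positivity)
  rw [Measure.toSphere_real_apply_univ, measureReal_def, EuclideanSpace.volume_ball]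
  simp only [ENNReal.ofReal_one, one_pow, one_mul, Fintype.card_fin, finrank_euclideanSpace]
  rw [ENNReal.toReal_ofReal (by positivity), Real.Gamma_add_one (by positivity),
    sqrt_eq_rpow, ← rpow_natCast, ← rpow_mul pi_pos.le]
  field_simp

lemma getoorFun_eq {d : ℕ} {s : ℝ} (hs : s ≠ 0) (x : EuclideanSpace ℝ (Fin d)) :
    getoorFun d s x = max (1 - ‖x‖ ^ 2) 0 ^ s := by
  unfold getoorFun
  split_ifs with h
  · rw [max_eq_left (by nlinarith [norm_nonneg x])]
  · rw [max_eq_right (by nlinarith [norm_nonneg x]), zero_rpow hs]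

lemma getoorFun_secondDiff_ray {d : ℕ} {s : ℝ} (hs : s ≠ 0) {x₀ θ : EuclideanSpace ℝ (Fin d)}
    (hx₀ : ‖x₀‖ < 1) (hθ : ‖θ‖ = 1) (r : ℝ) :
    2 * getoorFun d s x₀ - getoorFun d s (x₀ + r • θ) - getoorFun d s (x₀ - r • θ) =
      2 * (1 - ‖x₀‖ ^ 2) ^ s - max (1 - ‖x₀‖ ^ 2 - 2 * inner ℝ x₀ θ * r - r ^ 2) 0 ^ s -
        max (1 - ‖x₀‖ ^ 2 + 2 * inner ℝ x₀ θ * r - r ^ 2) 0 ^ s := by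
  rw [getoorFun_eq hs, getoorFun_eq hs, getoorFun_eq hs,
    max_eq_left (by nlinarith [norm_nonneg x₀]), norm_add_sq_real, norm_sub_sq_real, norm_smul,
    mul_pow, hθ, inner_smul_right, norm_eq_abs, sq_abs]
  congr 3 <;> ring_nf

lemma exists_getoorFun_secondDiff_bound {d : ℕ} {s : ℝ} (hs : s ∈ Ioo (0 : ℝ) 1)
    {x₀ : EuclideanSpace ℝ (Fin d)} (hx₀ : ‖x₀‖ < 1) :
    ∃ K, ∀ y, |2 * getoorFun d s x₀ - getoorFun d s (x₀ + y) - getoorFun d s (x₀ - y)| ≤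
      K * min 1 (‖y‖ ^ 2) := by
  have hc : 0 < 1 - ‖x₀‖ ^ 2 := by nlinarith [norm_nonneg x₀]
  obtain ⟨K, -, hK⟩ := exists_secondDiff_bound hc hs
  refine ⟨K, fun y => ?_⟩
  rcases eq_or_ne y 0 with rfl | hy
  · simp [two_mul]
  · have hy' : ‖y‖ ≠ 0 := norm_ne_zero_iff.2 hy
    have hθ : ‖‖y‖⁻¹ • y‖ = 1 := by simp [norm_smul, hy']
    have hb : |inner ℝ x₀ (‖y‖⁻¹ • y)| ≤ 1 :=
      (abs_real_inner_le_norm _ _).trans (by rw [hθ, mul_one]; exact hx₀.le)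
    have hray := getoorFun_secondDiff_ray hs.1.ne' hx₀ hθ ‖y‖
    rw [smul_smul, mul_inv_cancel₀ hy', one_smul] at hray
    rw [hray]
    exact hK _ _ hb (norm_nonneg y)

lemma integrable_getoorFun_secondDiff {d : ℕ} (hd : 1 ≤ d) {s : ℝ} (hs : s ∈ Ioo (0 : ℝ) 1)
    {x₀ : EuclideanSpace ℝ (Fin d)} (hx₀ : ‖x₀‖ < 1) :
    Integrable (fun y : EuclideanSpace ℝ (Fin d) =>
      (2 * getoorFun d s x₀ - getoorFun d s (x₀ + y) - getoorFun d s (x₀ - y)) /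
        ‖y‖ ^ ((d : ℝ) + 2 * s)) := by
  have : Nonempty (Fin d) := ⟨⟨0, hd⟩⟩
  obtain ⟨K, hK⟩ := exists_getoorFun_secondDiff_bound hs hx₀
  have hrad : Integrable (fun y : EuclideanSpace ℝ (Fin d) =>
      K * (min 1 (‖y‖ ^ 2) / ‖y‖ ^ ((d : ℝ) + 2 * s))) := by
    refine Integrable.const_mul ?_ K
    rw [integrable_fun_norm_addHaar volume
      (f := fun r : ℝ => min 1 (r ^ 2) / r ^ ((d : ℝ) + 2 * s))]
    refine (integrableOn_min_sq_mul_rpow hs).congr_fun (fun r hr => ?_) measurableSet_Ioi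
    have hr : 0 < r := hr
    simp only [finrank_euclideanSpace, Fintype.card_fin, smul_eq_mul]
    rw [div_eq_mul_inv, ← rpow_neg hr.le, ← rpow_natCast r (d - 1), mul_left_comm, ← rpow_add hr,
      Nat.cast_sub hd]
    congr 2
    push_cast
    ring
  have hmeas : Measurable (getoorFun d s) := by
    have : getoorFun d s = fun x => max (1 - ‖x‖ ^ 2) 0 ^ s :=
      funext fun x => getoorFun_eq hs.1.ne' x
    rw [this]
    fun_prop
  refine hrad.mono' (Measurable.aestronglyMeasurable (by fun_prop))
    (Eventually.of_forall fun y => ?_)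
  have hpos : 0 ≤ ‖y‖ ^ ((d : ℝ) + 2 * s) := rpow_nonneg (norm_nonneg y) _
  rw [norm_eq_abs, abs_div, abs_of_nonneg hpos, ← mul_div_assoc]
  exact div_le_div_of_nonneg_right (hK y) hpos

lemma integral_getoorFun_secondDiff {d : ℕ} (hd : 1 ≤ d) {s : ℝ} (hs : s ∈ Ioo (0 : ℝ) 1)
    {x₀ : EuclideanSpace ℝ (Fin d)} (hx₀ : ‖x₀‖ < 1) :
    ∫ y : EuclideanSpace ℝ (Fin d),
      (2 * getoorFun d s x₀ - getoorFun d s (x₀ + y) - getoorFun d s (x₀ - y)) /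
        ‖y‖ ^ ((d : ℝ) + 2 * s) =
      2 * π ^ ((d : ℝ) / 2) / Real.Gamma ((d : ℝ) / 2) *
        (Real.Gamma s * Real.Gamma (1 - s)) := by
  have : Nonempty (Fin d) := ⟨⟨0, hd⟩⟩
  have hc : 0 < 1 - ‖x₀‖ ^ 2 := by nlinarith [norm_nonneg x₀]
  rw [integral_eq_integral_toSphere_Ioi _ (integrable_getoorFun_secondDiff hd hs hx₀)]
  have hinner : ∀ θ : Metric.sphere (0 : EuclideanSpace ℝ (Fin d)) 1,
      ∫ r in Ioi (0 : ℝ), r ^ (Module.finrank ℝ (EuclideanSpace ℝ (Fin d)) - 1) *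
        ((2 * getoorFun d s x₀ - getoorFun d s (x₀ + r • (θ : EuclideanSpace ℝ (Fin d))) -
          getoorFun d s (x₀ - r • (θ : EuclideanSpace ℝ (Fin d)))) /
            ‖r • (θ : EuclideanSpace ℝ (Fin d))‖ ^ ((d : ℝ) + 2 * s)) =
        Real.Gamma s * Real.Gamma (1 - s) := by
    intro θ
    have hθ : ‖(θ : EuclideanSpace ℝ (Fin d))‖ = 1 := by simp
    set b : ℝ := inner ℝ x₀ (θ : EuclideanSpace ℝ (Fin d)) with hb
    have hb1 : |b| ≤ 1 :=
      (abs_real_inner_le_norm _ _).trans (by rw [hθ, mul_one]; exact hx₀.le)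
    have hint : IntegrableOn (fun r : ℝ => (2 * (1 - ‖x₀‖ ^ 2) ^ s -
        max (1 - ‖x₀‖ ^ 2 - 2 * b * r - r ^ 2) 0 ^ s -
        max (1 - ‖x₀‖ ^ 2 + 2 * b * r - r ^ 2) 0 ^ s) * r ^ (-1 - 2 * s)) (Ioi 0) := by
      obtain ⟨K, -, hK⟩ := exists_secondDiff_bound hc hs
      refine ((integrableOn_min_sq_mul_rpow hs).const_mul K).mono'
        (Measurable.aestronglyMeasurable (by fun_prop)) ?_
      filter_upwards [ae_restrict_mem measurableSet_Ioi] with r hr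
      have hr : 0 < r := hr
      have hpos : 0 ≤ r ^ (-1 - 2 * s) := rpow_nonneg hr.le _
      rw [norm_mul, norm_eq_abs, norm_eq_abs, abs_of_nonneg hpos, ← mul_assoc]
      exact mul_le_mul_of_nonneg_right (hK b r hb1 hr.le) hpos
    rw [← integral_secondDiff hc hs hint]
    refine setIntegral_congr_fun measurableSet_Ioi fun r hr => ?_
    have hr : 0 < r := hr
    simp only [finrank_euclideanSpace, Fintype.card_fin]
    rw [getoorFun_secondDiff_ray hs.1.ne' hx₀ hθ, norm_smul, hθ, mul_one, norm_eq_abs,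
      abs_of_pos hr, div_eq_mul_inv, ← rpow_neg hr.le, ← rpow_natCast r (d - 1), mul_left_comm,
      ← rpow_add hr, Nat.cast_sub hd]
    congr 2
    push_cast
    ring
  simp_rw [hinner]
  rw [integral_const, toSphere_real_univ_euclideanSpace hd, smul_eq_mul]

/-- Getoor's explicit solution: for `u(x) = (1-|x|²)₊^s` and every `x₀` in the open unit
ball, the second-difference quotient `y ↦ (2u(x₀)-u(x₀+y)-u(x₀-y))/|y|^(d+2s)` is
Lebesgue integrable on `ℝ^d` and
`(C(d,s)/2) ∫ (2u(x₀)-u(x₀+y)-u(x₀-y))/|y|^(d+2s) dy = 2^(2s) Γ((d+2s)/2) Γ(1+s)/Γ(d/2)`;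
equivalently, `x ↦ (Γ(d/2)/(2^(2s)Γ((d+2s)/2)Γ(1+s))) (1-|x|²)₊^s` solves `(-Δ)^s u = 1`
in the unit ball, with zero values outside. -/
theorem getoor_solution (d : ℕ) (hd : 1 ≤ d) (s : ℝ) (hs : s ∈ Set.Ioo (0 : ℝ) 1)
    (x₀ : EuclideanSpace ℝ (Fin d)) (hx₀ : ‖x₀‖ < 1) :
    MeasureTheory.Integrable (fun y : EuclideanSpace ℝ (Fin d) =>
        (2 * getoorFun d s x₀ - getoorFun d s (x₀ + y) - getoorFun d s (x₀ - y)) /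
          ‖y‖ ^ ((d : ℝ) + 2 * s)) ∧
      fracLapConst d s / 2 *
          ∫ y : EuclideanSpace ℝ (Fin d),
            (2 * getoorFun d s x₀ - getoorFun d s (x₀ + y) - getoorFun d s (x₀ - y)) /
              ‖y‖ ^ ((d : ℝ) + 2 * s) =
        2 ^ (2 * s) * Real.Gamma (((d : ℝ) + 2 * s) / 2) * Real.Gamma (1 + s) /
          Real.Gamma ((d : ℝ) / 2) ∧
      fracLapConst d s / 2 *
          ∫ y : EuclideanSpace ℝ (Fin d),
            (2 * (Real.Gamma ((d : ℝ) / 2) /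
                  (2 ^ (2 * s) * Real.Gamma (((d : ℝ) + 2 * s) / 2) * Real.Gamma (1 + s)) *
                    getoorFun d s x₀) -
              Real.Gamma ((d : ℝ) / 2) /
                  (2 ^ (2 * s) * Real.Gamma (((d : ℝ) + 2 * s) / 2) * Real.Gamma (1 + s)) *
                getoorFun d s (x₀ + y) -
              Real.Gamma ((d : ℝ) / 2) /
                  (2 ^ (2 * s) * Real.Gamma (((d : ℝ) + 2 * s) / 2) * Real.Gamma (1 + s)) *
                getoorFun d s (x₀ - y)) /
              ‖y‖ ^ ((d : ℝ) + 2 * s) = 1 := by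
  have hd0 : (0 : ℝ) < d := by exact_mod_cast hd
  have hval : fracLapConst d s / 2 *
      ∫ y : EuclideanSpace ℝ (Fin d),
        (2 * getoorFun d s x₀ - getoorFun d s (x₀ + y) - getoorFun d s (x₀ - y)) /
          ‖y‖ ^ ((d : ℝ) + 2 * s) =
      2 ^ (2 * s) * Real.Gamma (((d : ℝ) + 2 * s) / 2) * Real.Gamma (1 + s) /
        Real.Gamma ((d : ℝ) / 2) := by
    have hG : 0 < Real.Gamma ((d : ℝ) / 2) := Real.Gamma_pos_of_pos (by positivity)
    have hG1 : 0 < Real.Gamma (1 - s) := Real.Gamma_pos_of_pos (by linarith [hs.2])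
    have harg : s + (d : ℝ) / 2 = ((d : ℝ) + 2 * s) / 2 := by ring
    rw [integral_getoorFun_secondDiff hd hs hx₀, fracLapConst, harg, add_comm 1 s,
      Real.Gamma_add_one hs.1.ne']
    field_simp
  refine ⟨integrable_getoorFun_secondDiff hd hs hx₀, hval, ?_⟩
  have hG : 0 < Real.Gamma ((d : ℝ) / 2) := Real.Gamma_pos_of_pos (by positivity)
  have hG1 : 0 < Real.Gamma (1 + s) := Real.Gamma_pos_of_pos (by linarith [hs.1])
  have hG2 : 0 < Real.Gamma (((d : ℝ) + 2 * s) / 2) :=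
    Real.Gamma_pos_of_pos (by linarith [hs.1])
  set κ : ℝ := Real.Gamma ((d : ℝ) / 2) /
    (2 ^ (2 * s) * Real.Gamma (((d : ℝ) + 2 * s) / 2) * Real.Gamma (1 + s)) with hκ
  have hfun : ∀ y : EuclideanSpace ℝ (Fin d),
      (2 * (κ * getoorFun d s x₀) - κ * getoorFun d s (x₀ + y) - κ * getoorFun d s (x₀ - y)) /
        ‖y‖ ^ ((d : ℝ) + 2 * s) =
      κ * ((2 * getoorFun d s x₀ - getoorFun d s (x₀ + y) - getoorFun d s (x₀ - y)) /
        ‖y‖ ^ ((d : ℝ) + 2 * s)) := fun y => by ring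
  simp_rw [hfun]
  rw [integral_const_mul, mul_left_comm, hval, hκ]
  field_simp
end

section
/- Let d ≥ 1 and s ∈ (0,1). For every ξ ∈ ℝ^d, the function y ↦ (2 − 2cos(ξ·y))/|y|^{d+2s} is Lebesgue integrable on ℝ^d and (C(d,s)/2) ∫_{ℝ^d} (2 − 2cos(ξ·y))/|y|^{d+2s} dy = |ξ|^{2s}. -/
open MeasureTheory Real Set
open scoped RealInnerProductSpace

/-- **Tonelli's theorem** for real-valued functions: if a nonnegative function has an integrable
iterated integral in one order, then it has one in the other order, with the same value. -/
theorem integrable_integral_and_integral_swap_of_nonneg {α β : Type*} [MeasurableSpace α]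
    [MeasurableSpace β] {μ : Measure α} {ν : Measure β} [SFinite μ] [SFinite ν] {f : α → β → ℝ}
    (hf : AEStronglyMeasurable (Function.uncurry f) (μ.prod ν))
    (hf_nonneg : ∀ᵐ y ∂ν, ∀ᵐ x ∂μ, 0 ≤ f x y)
    (hf_int : ∀ᵐ y ∂ν, Integrable (fun x => f x y) μ)
    (hf_int' : Integrable (fun y => ∫ x, f x y ∂μ) ν) :
    Integrable (fun x => ∫ y, f x y ∂ν) μ ∧
      ∫ x, ∫ y, f x y ∂ν ∂μ = ∫ y, ∫ x, f x y ∂μ ∂ν := by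
  have h : Integrable (Function.uncurry f) (μ.prod ν) := by
    rw [integrable_prod_iff' hf]
    refine ⟨hf_int, hf_int'.congr ?_⟩
    filter_upwards [hf_nonneg] with y hy
    refine integral_congr_ae ?_
    filter_upwards [hy] with x hx
    exact (Real.norm_of_nonneg hx).symm
  exact ⟨h.integral_prod_left, integral_integral_swap h⟩

theorem integrableOn_rpow_mul_exp_neg_mul_Ioi {a r : ℝ} (ha : 0 < a) (hr : 0 < r) :
    IntegrableOn (fun t : ℝ => t ^ (a - 1) * exp (-(r * t))) (Ioi 0) := by
  refine not_imp_comm.1 integral_undef ?_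
  rw [integral_rpow_mul_exp_neg_mul_Ioi ha hr]
  have := Gamma_pos_of_pos ha
  positivity

theorem intervalIntegral_exp_neg_mul {u : ℝ} (hu : u ≠ 0) (b : ℝ) :
    ∫ r in (0 : ℝ)..b, exp (-(r * u)) = (1 - exp (-(b * u))) / u := by
  have h : ∀ r ∈ uIcc 0 b, HasDerivAt (fun r => -exp (-(r * u)) / u) (exp (-(r * u))) r := by
    intro r _
    convert! (hasDerivAt_mul_const u (x := r)).fun_neg.exp.fun_neg.div_const u using 1
    field_simp
  rw [intervalIntegral.integral_eq_sub_of_hasDerivAt h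
    (Continuous.intervalIntegrable (by fun_prop) _ _)]
  simp
  ring

theorem integral_rpow_mul_one_sub_exp_neg_mul_Ioi {s : ℝ} (hs : s ∈ Ioo (0 : ℝ) 1) {b : ℝ}
    (hb : 0 ≤ b) :
    IntegrableOn (fun u : ℝ => u ^ (-s - 1) * (1 - exp (-(b * u)))) (Ioi 0) ∧
      ∫ u in Ioi (0 : ℝ), u ^ (-s - 1) * (1 - exp (-(b * u))) = Gamma (1 - s) * (b ^ s / s) := by
  obtain ⟨hs0, hs1⟩ := hs
  have h1s : 0 < 1 - s := by linarith
  have hval : ∀ r ∈ Ioc (0 : ℝ) b,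
      ∫ u in Ioi (0 : ℝ), u ^ (1 - s - 1) * exp (-(r * u)) = Gamma (1 - s) * r ^ (s - 1) := by
    intro r hr
    rw [integral_rpow_mul_exp_neg_mul_Ioi h1s hr.1, one_div, inv_rpow hr.1.le, ← rpow_neg hr.1.le,
      mul_comm, neg_sub]
  have hval' : ∀ u ∈ Ioi (0 : ℝ), ∫ r in Ioc 0 b, u ^ (1 - s - 1) * exp (-(r * u)) =
      u ^ (-s - 1) * (1 - exp (-(b * u))) := by
    intro u hu
    rw [integral_const_mul, ← intervalIntegral.integral_of_le hb,
      intervalIntegral_exp_neg_mul (ne_of_gt hu), show 1 - s - 1 = -s by ring,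
      rpow_sub_one (ne_of_gt hu)]
    ring
  have hr_int : IntegrableOn (fun r : ℝ => Gamma (1 - s) * r ^ (s - 1)) (Ioc 0 b) :=
    ((intervalIntegrable_iff_integrableOn_Ioc_of_le hb).1
      (intervalIntegral.intervalIntegrable_rpow' (by linarith))).const_mul _
  obtain ⟨h₁, h₂⟩ := integrable_integral_and_integral_swap_of_nonneg
    (μ := volume.restrict (Ioi (0 : ℝ))) (ν := volume.restrict (Ioc 0 b))
    (f := fun u r => u ^ (1 - s - 1) * exp (-(r * u)))
    (Measurable.aestronglyMeasurable (by unfold Function.uncurry; fun_prop))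
    (.of_forall fun r => (ae_restrict_mem measurableSet_Ioi).mono fun u hu =>
      mul_nonneg (rpow_nonneg (le_of_lt hu) _) (exp_nonneg _))
    ((ae_restrict_mem measurableSet_Ioc).mono fun r hr =>
      integrableOn_rpow_mul_exp_neg_mul_Ioi h1s hr.1)
    (IntegrableOn.congr_fun hr_int (fun r hr => (hval r hr).symm) measurableSet_Ioc)
  refine ⟨IntegrableOn.congr_fun h₁ hval' measurableSet_Ioi, ?_⟩
  rw [← setIntegral_congr_fun measurableSet_Ioi hval', h₂,
    setIntegral_congr_fun measurableSet_Ioc hval, integral_const_mul,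
    ← intervalIntegral.integral_of_le hb, integral_rpow (Or.inl (by linarith))]
  simp [zero_rpow hs0.ne']

theorem integral_rpow_mul_one_sub_exp_neg_div_Ioi {s : ℝ} (hs : s ∈ Ioo (0 : ℝ) 1) {b : ℝ}
    (hb : 0 ≤ b) :
    IntegrableOn (fun t : ℝ => t ^ (s - 1) * (1 - exp (-(b / t)))) (Ioi 0) ∧
      ∫ t in Ioi (0 : ℝ), t ^ (s - 1) * (1 - exp (-(b / t))) = Gamma (1 - s) * (b ^ s / s) := by
  obtain ⟨h₁, h₂⟩ := integral_rpow_mul_one_sub_exp_neg_mul_Ioi hs hb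
  have h : EqOn (fun t : ℝ => (|(-1 : ℝ)| * t ^ ((-1 : ℝ) - 1)) •
      ((t ^ (-1 : ℝ)) ^ (-s - 1) * (1 - exp (-(b * t ^ (-1 : ℝ))))))
      (fun t : ℝ => t ^ (s - 1) * (1 - exp (-(b / t)))) (Ioi 0) := by
    intro t ht
    have ht : 0 < t := ht
    simp only [abs_neg, abs_one, one_mul, smul_eq_mul]
    rw [← mul_assoc, ← rpow_mul ht.le, ← rpow_add ht, rpow_neg_one, ← div_eq_mul_inv]
    ring_nf
  rw [← integrableOn_Ioi_comp_rpow_iff _ (neg_ne_zero.2 one_ne_zero)] at h₁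
  rw [← integral_comp_rpow_Ioi _ (neg_ne_zero.2 one_ne_zero)] at h₂
  exact ⟨h₁.congr_fun h measurableSet_Ioi, (setIntegral_congr_fun measurableSet_Ioi h) ▸ h₂⟩

section InnerProductSpace

variable {V : Type*} [NormedAddCommGroup V] [InnerProductSpace ℝ V] [FiniteDimensional ℝ V]
  [MeasurableSpace V] [BorelSpace V]

theorem integral_cos_inner_mul_exp_neg_mul_sq_norm {t : ℝ} (ht : 0 < t) (ξ : V) :
    Integrable (fun y : V => cos ⟪ξ, y⟫ * exp (-(t * ‖y‖ ^ 2))) ∧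
      ∫ y : V, cos ⟪ξ, y⟫ * exp (-(t * ‖y‖ ^ 2)) =
        (π / t) ^ (Module.finrank ℝ V / 2 : ℝ) * exp (-(‖ξ‖ ^ 2 / 4 / t)) := by
  have ht' : 0 < (t : ℂ).re := ht
  have hre : ∀ y : V, RCLike.re (Complex.exp (-t * ‖y‖ ^ 2 + Complex.I * ⟪ξ, y⟫)) =
      cos ⟪ξ, y⟫ * exp (-(t * ‖y‖ ^ 2)) := by
    intro y
    have : (-t * ‖y‖ ^ 2 : ℂ) = ((-(t * ‖y‖ ^ 2) : ℝ) : ℂ) := by push_cast; ring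
    rw [Complex.exp_add, mul_comm Complex.I, this, ← Complex.ofReal_exp, RCLike.re_eq_complex_re,
      Complex.re_ofReal_mul, Complex.exp_ofReal_mul_I_re, mul_comm]
  have hint := GaussianFourier.integrable_cexp_neg_mul_sq_norm_add ht' Complex.I ξ
  have hval := GaussianFourier.integral_cexp_neg_mul_sq_norm_add ht' Complex.I ξ
  refine ⟨hint.re.congr (.of_forall hre), ?_⟩
  have h := integral_re hint
  simp_rw [hre] at h
  rw [h, hval]
  have h₁ : Complex.I ^ 2 * ‖ξ‖ ^ 2 / (4 * t) = ((-(‖ξ‖ ^ 2 / 4 / t) : ℝ) : ℂ) := by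
    rw [Complex.I_sq]
    push_cast
    field_simp
  have h₂ : (π / t : ℂ) ^ (Module.finrank ℝ V / 2 : ℂ) =
      (((π / t) ^ (Module.finrank ℝ V / 2 : ℝ) : ℝ) : ℂ) := by
    rw [Complex.ofReal_cpow (by positivity)]
    push_cast
    rfl
  rw [h₁, h₂, ← Complex.ofReal_exp, ← Complex.ofReal_mul]
  exact Complex.ofReal_re _

theorem integral_two_sub_two_mul_cos_inner_mul_exp_neg_mul_sq_norm {t : ℝ} (ht : 0 < t) (ξ : V) :
    Integrable (fun y : V => (2 - 2 * cos ⟪ξ, y⟫) * exp (-(t * ‖y‖ ^ 2))) ∧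
      ∫ y : V, (2 - 2 * cos ⟪ξ, y⟫) * exp (-(t * ‖y‖ ^ 2)) =
        2 * (π / t) ^ (Module.finrank ℝ V / 2 : ℝ) * (1 - exp (-(‖ξ‖ ^ 2 / 4 / t))) := by
  obtain ⟨h₁, h₂⟩ := integral_cos_inner_mul_exp_neg_mul_sq_norm ht ξ
  obtain ⟨h₃, h₄⟩ := integral_cos_inner_mul_exp_neg_mul_sq_norm ht (0 : V)
  have h : (fun y : V => (2 - 2 * cos ⟪ξ, y⟫) * exp (-(t * ‖y‖ ^ 2))) = fun y =>
      2 * (cos ⟪0, y⟫ * exp (-(t * ‖y‖ ^ 2))) - 2 * (cos ⟪ξ, y⟫ * exp (-(t * ‖y‖ ^ 2))) := by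
    ext y
    rw [inner_zero_left, cos_zero]
    ring
  rw [h]
  refine ⟨(h₃.const_mul 2).sub (h₁.const_mul 2), ?_⟩
  rw [integral_sub (h₃.const_mul 2) (h₁.const_mul 2), integral_const_mul, integral_const_mul,
    h₂, h₄]
  simp
  ring

theorem integral_two_sub_two_mul_cos_inner_div_norm_rpow {s : ℝ} (hs : s ∈ Ioo (0 : ℝ) 1) (ξ : V) :
    Integrable (fun y : V =>
        (2 - 2 * cos ⟪ξ, y⟫) / ‖y‖ ^ ((Module.finrank ℝ V : ℝ) + 2 * s)) ∧
      ∫ y : V, (2 - 2 * cos ⟪ξ, y⟫) / ‖y‖ ^ ((Module.finrank ℝ V : ℝ) + 2 * s) =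
        2 * π ^ (Module.finrank ℝ V / 2 : ℝ) * (Gamma (1 - s) * ((‖ξ‖ ^ 2 / 4) ^ s / s)) /
          Gamma (s + Module.finrank ℝ V / 2) := by
  set a : ℝ := s + Module.finrank ℝ V / 2 with ha_def
  have ha : 0 < a := add_pos_of_pos_of_nonneg hs.1 (by positivity)
  have hΓ := Gamma_pos_of_pos ha
  have hinner : ∀ y : V,
      ∫ t in Ioi (0 : ℝ), t ^ (a - 1) * ((2 - 2 * cos ⟪ξ, y⟫) * exp (-(t * ‖y‖ ^ 2))) =
        Gamma a * ((2 - 2 * cos ⟪ξ, y⟫) / ‖y‖ ^ ((Module.finrank ℝ V : ℝ) + 2 * s)) := by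
    intro y
    rcases eq_or_ne y 0 with rfl | hy
    · simp
    have hy' : 0 < ‖y‖ := norm_pos_iff.2 hy
    have h : ∀ t : ℝ, t ^ (a - 1) * ((2 - 2 * cos ⟪ξ, y⟫) * exp (-(t * ‖y‖ ^ 2))) =
        (2 - 2 * cos ⟪ξ, y⟫) * (t ^ (a - 1) * exp (-(‖y‖ ^ 2 * t))) := fun t => by
      rw [mul_left_comm, mul_comm t]
    simp_rw [h]
    rw [integral_const_mul, integral_rpow_mul_exp_neg_mul_Ioi ha (pow_pos hy' 2),
      one_div, inv_rpow (by positivity), ← rpow_natCast, ← rpow_mul hy'.le,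
      show ((2 : ℕ) : ℝ) * a = Module.finrank ℝ V + 2 * s by rw [ha_def]; push_cast; ring]
    ring
  have houter : ∀ t ∈ Ioi (0 : ℝ),
      ∫ y : V, t ^ (a - 1) * ((2 - 2 * cos ⟪ξ, y⟫) * exp (-(t * ‖y‖ ^ 2))) =
        2 * π ^ (Module.finrank ℝ V / 2 : ℝ) *
          (t ^ (s - 1) * (1 - exp (-(‖ξ‖ ^ 2 / 4 / t)))) := by
    intro t ht
    have ht : 0 < t := ht
    rw [integral_const_mul, (integral_two_sub_two_mul_cos_inner_mul_exp_neg_mul_sq_norm ht ξ).2,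
      div_rpow pi_pos.le ht.le, show a - 1 = (s - 1) + Module.finrank ℝ V / 2 by rw [ha_def]; ring,
      rpow_add ht]
    have := rpow_pos_of_pos ht (Module.finrank ℝ V / 2 : ℝ)
    field_simp
  obtain ⟨hI, hI'⟩ := integral_rpow_mul_one_sub_exp_neg_div_Ioi hs
    (show 0 ≤ ‖ξ‖ ^ 2 / 4 by positivity)
  obtain ⟨h₁, h₂⟩ := integrable_integral_and_integral_swap_of_nonneg
    (μ := (volume : Measure V)) (ν := volume.restrict (Ioi (0 : ℝ)))
    (f := fun y t => t ^ (a - 1) * ((2 - 2 * cos ⟪ξ, y⟫) * exp (-(t * ‖y‖ ^ 2))))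
    (Measurable.aestronglyMeasurable (by unfold Function.uncurry; fun_prop))
    ((ae_restrict_mem measurableSet_Ioi).mono fun t ht => .of_forall fun y =>
      mul_nonneg (rpow_nonneg (le_of_lt ht) _)
        (mul_nonneg (by linarith [cos_le_one ⟪ξ, y⟫]) (exp_nonneg _)))
    ((ae_restrict_mem measurableSet_Ioi).mono fun t ht =>
      (integral_two_sub_two_mul_cos_inner_mul_exp_neg_mul_sq_norm ht ξ).1.const_mul _)
    (IntegrableOn.congr_fun (hI.const_mul _) (fun t ht => (houter t ht).symm) measurableSet_Ioi)
  simp_rw [hinner] at h₁ h₂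
  rw [setIntegral_congr_fun measurableSet_Ioi houter, integral_const_mul, integral_const_mul,
    hI'] at h₂
  exact ⟨(integrable_const_mul_iff hΓ.ne'.isUnit _).1 h₁, by rw [← h₂]; field_simp⟩

end InnerProductSpace

/-- Fourier-symbol computation for the fractional Laplacian: for every `ξ ∈ ℝ^d` the
function `y ↦ (2 - 2cos(ξ·y))/|y|^(d+2s)` is Lebesgue integrable on `ℝ^d` and
`(C(d,s)/2) ∫ (2 - 2cos(ξ·y))/|y|^(d+2s) dy = |ξ|^(2s)`. -/
theorem fracLap_symbol (d : ℕ) (hd : 1 ≤ d) (s : ℝ) (hs : s ∈ Set.Ioo (0 : ℝ) 1)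
    (ξ : EuclideanSpace ℝ (Fin d)) :
    MeasureTheory.Integrable (fun y : EuclideanSpace ℝ (Fin d) =>
        (2 - 2 * Real.cos (⟪ξ, y⟫ : ℝ)) / ‖y‖ ^ ((d : ℝ) + 2 * s)) ∧
      fracLapConst d s / 2 *
          ∫ y : EuclideanSpace ℝ (Fin d),
            (2 - 2 * Real.cos (⟪ξ, y⟫ : ℝ)) / ‖y‖ ^ ((d : ℝ) + 2 * s) =
        ‖ξ‖ ^ (2 * s) := by
  obtain ⟨h₁, h₂⟩ := integral_two_sub_two_mul_cos_inner_div_norm_rpow hs ξ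
  rw [finrank_euclideanSpace_fin] at h₁ h₂
  refine ⟨h₁, ?_⟩
  have hs0 : 0 < s := hs.1
  have hΓ := Gamma_pos_of_pos (show 0 < s + d / 2 by positivity)
  have hΓ' := Gamma_pos_of_pos (show 0 < 1 - s by linarith [hs.2])
  have hpow : (2 : ℝ) ^ (2 * s) * (‖ξ‖ ^ 2 / 4) ^ s = ‖ξ‖ ^ (2 * s) := by
    rw [show ‖ξ‖ ^ 2 / 4 = (‖ξ‖ / 2) ^ (2 : ℝ) by rw [rpow_two]; ring, ← rpow_mul (by positivity),
      ← mul_rpow (by positivity) (by positivity)]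
    congr 1
    ring
  rw [h₂, fracLapConst, ← hpow]
  field_simp
end

section
/- Let s ∈ (0,1). There exists a constant C > 0, depending only on s, such that for every k ∈ (0,1] and every real λ ≥ 1, setting N₊ := ⌈π²/(4 s k²)⌉ and N₋ := ⌈π²/(4 (1−s) k²)⌉, one has | λ^{−s} − (sin(sπ)/π) k Σ_{ℓ=−N₋}^{N₊} e^{(1−s) k ℓ} / ( e^{k ℓ} + λ ) | ≤ C e^{−π²/(4k)}. -/
open Real Set

section BalakrishnanIntegral

open MeasureTheory Complex in
/-- The Mellin transform of `1 / (1 + x)`, written with an exponential change of variables. -/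
theorem integral_cexp_mul_div_exp_add_one {w : ℂ} (h0 : 0 < w.re) (h1 : w.re < 1) :
    ∫ y : ℝ, cexp (w * y) / (cexp y + 1) = π / Complex.sin (π * w) := by
  have hbeta : betaIntegral w (1 - w) = π / Complex.sin (π * w) := by
    have h := Complex.Gamma_mul_Gamma_eq_betaIntegral h0
      (show 0 < (1 - w).re by simpa using h1)
    rw [← Complex.Gamma_mul_Gamma_one_sub, h]
    simp
  rw [← hbeta, betaIntegral, intervalIntegral.integral_of_le zero_le_one,
    integral_Ioc_eq_integral_Ioo, ← Real.range_sigmoid, ← Set.image_univ,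
    integral_image_eq_integral_abs_deriv_smul MeasurableSet.univ
      (fun y _ => (Real.hasDerivAt_sigmoid y).hasDerivWithinAt)
      Real.sigmoid_injective.injOn, Measure.restrict_univ]
  congr 1 with y
  have hpos := Real.sigmoid_pos y
  have hpos' : 0 < 1 - Real.sigmoid y := sub_pos.2 (Real.sigmoid_lt_one y)
  have hlog : Real.log (Real.sigmoid y) = y + Real.log (1 - Real.sigmoid y) := by
    rw [← Real.sigmoid_neg, ← Real.sigmoid_mul_rexp_neg, Real.log_mul hpos.ne' (exp_ne_zero _),
      Real.log_exp]
    ring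
  have hs : (1 - (Real.sigmoid y : ℂ)) = ((1 - Real.sigmoid y : ℝ) : ℂ) := by push_cast; ring
  have hinv : (cexp y + 1)⁻¹ = ((1 - Real.sigmoid y : ℝ) : ℂ) := by
    rw [← Real.sigmoid_neg, Real.sigmoid_def]
    push_cast
    rw [neg_neg, add_comm]
  rw [abs_of_pos (mul_pos hpos hpos'), hs, div_eq_mul_inv, hinv,
    Complex.cpow_sub _ _ (ofReal_ne_zero.2 hpos.ne'), show 1 - w - 1 = -w by ring,
    Complex.cpow_neg, Complex.cpow_one, Complex.cpow_def_of_ne_zero (ofReal_ne_zero.2 hpos.ne'),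
    Complex.cpow_def_of_ne_zero (ofReal_ne_zero.2 hpos'.ne'), ← Complex.ofReal_log hpos.le,
    ← Complex.ofReal_log hpos'.le, hlog, real_smul]
  have hne : (Real.sigmoid y : ℂ) ≠ 0 := ofReal_ne_zero.2 hpos.ne'
  push_cast
  rw [add_mul, Complex.exp_add, mul_comm w]
  field_simp [Complex.exp_ne_zero]

/-- The modulus of `sin` grows exponentially away from the real axis. -/
theorem exp_abs_im_div_four_le_norm_sin {z : ℂ} (hz : 1 ≤ |z.im|) :
    Real.exp |z.im| / 4 ≤ ‖Complex.sin z‖ := by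
  have hle : Real.exp (-|z.im|) ≤ Real.exp |z.im| / 2 := by
    have h1 : (2 : ℝ) ≤ Real.exp (|z.im| + |z.im|) := by
      linarith [Real.add_one_le_exp (|z.im| + |z.im|)]
    rw [Real.exp_add] at h1
    have h2 : Real.exp (-|z.im|) * Real.exp |z.im| = 1 := by rw [← Real.exp_add]; simp
    nlinarith [Real.exp_pos (-|z.im|), Real.exp_pos |z.im|]
  have hn : ‖Complex.sin z‖ = ‖Complex.exp (-z * Complex.I) - Complex.exp (z * Complex.I)‖ / 2 := by
    simp [Complex.sin]
  have h := abs_norm_sub_norm_le (Complex.exp (-z * Complex.I)) (Complex.exp (z * Complex.I))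
  rw [Complex.norm_exp, Complex.norm_exp] at h
  simp only [Complex.mul_re, Complex.neg_re, Complex.neg_im, Complex.I_re, Complex.I_im,
    mul_zero, mul_one, zero_sub, neg_neg] at h
  rw [hn]
  rcases abs_cases z.im with ⟨he, _⟩ | ⟨he, _⟩ <;> rw [he] at hle ⊢
  · linarith [le_abs_self (Real.exp z.im - Real.exp (-z.im))]
  · rw [neg_neg] at hle
    linarith [neg_le_abs (Real.exp z.im - Real.exp (-z.im))]

end BalakrishnanIntegral

section Tail

theorem exists_hasSum_exp_tail {c : ℝ} (hc : 0 < c) (N : ℤ) :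
    ∃ a ≤ Real.exp (-(c * N)) / c,
      HasSum (fun n : ℤ => if N < n then Real.exp (-(c * n)) else 0) a := by
  have hr1 : Real.exp (-c) < 1 := by simpa using hc
  refine ⟨Real.exp (-(c * N)) * Real.exp (-c) * (1 - Real.exp (-c))⁻¹, ?_, ?_⟩
  · have h1 : c ≤ Real.exp c - 1 := by linarith [Real.add_one_le_exp c]
    have h2 : Real.exp (-c) * (1 - Real.exp (-c))⁻¹ = (Real.exp c - 1)⁻¹ := by
      rw [Real.exp_neg]
      have : Real.exp c - 1 ≠ 0 := by linarith
      field_simp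
    rw [mul_assoc, h2, div_eq_mul_inv]
    gcongr
  · have hg : Function.Injective (fun j : ℕ => N + 1 + (j : ℤ)) := fun i j h => by
      simpa using h
    rw [← hg.hasSum_iff]
    · refine HasSum.congr_fun ((hasSum_geometric_of_lt_one (Real.exp_pos (-c)).le hr1).mul_left
        (Real.exp (-(c * N)) * Real.exp (-c))) fun j => ?_
      simp only [Function.comp_apply]
      rw [if_pos (by lia), ← Real.exp_nat_mul, ← Real.exp_add, ← Real.exp_add]
      push_cast
      ring_nf
    · intro n hn
      rw [if_neg]
      intro h
      exact hn ⟨(n - (N + 1)).toNat, by lia⟩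

/-- Truncating a two-sided series with exponentially decaying nonnegative terms. -/
theorem summable_and_abs_tsum_sub_sum_Icc_le {F : ℤ → ℝ} {α β : ℝ} (hα : 0 < α) (hβ : 0 < β)
    (h0 : ∀ n, 0 ≤ F n) (hFα : ∀ n : ℤ, F n ≤ Real.exp (-(α * n)))
    (hFβ : ∀ n : ℤ, F n ≤ Real.exp (β * n)) (M N : ℤ) :
    Summable F ∧ |∑' n, F n - ∑ n ∈ Finset.Icc (-M) N, F n| ≤
      Real.exp (-(α * N)) / α + Real.exp (-(β * M)) / β := by
  obtain ⟨a, ha, hsa⟩ := exists_hasSum_exp_tail hα N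
  obtain ⟨b, hb, hsb⟩ := exists_hasSum_exp_tail hβ M
  rw [← (Equiv.neg ℤ).hasSum_iff] at hsb
  have hfin : HasSum (fun n => if n ∈ Finset.Icc (-M) N then F n else 0)
      (∑ n ∈ Finset.Icc (-M) N, F n) := by
    have h := hasSum_sum_of_ne_finset_zero (L := .unconditional ℤ) (s := Finset.Icc (-M) N)
      (f := fun n => if n ∈ Finset.Icc (-M) N then F n else 0) (fun n hn => if_neg hn)
    rwa [Finset.sum_congr rfl (fun n hn => if_pos hn)] at h
  have htot := (hfin.add hsa).add hsb
  have hle : ∀ n, F n ≤ (if n ∈ Finset.Icc (-M) N then F n else 0) +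
      (if N < n then Real.exp (-(α * n)) else 0) +
      ((fun n : ℤ => if M < n then Real.exp (-(β * n)) else 0) ∘ Equiv.neg ℤ) n := by
    intro n
    simp only [Function.comp_apply, Equiv.neg_apply, Int.cast_neg, mul_neg, neg_neg,
      Finset.mem_Icc]
    have e1 := Real.exp_pos (-(α * n))
    have e2 := Real.exp_pos (β * n)
    have := h0 n
    have := hFα n
    have := hFβ n
    split_ifs <;> first | linarith | omega
  have hF : Summable F := Summable.of_nonneg_of_le h0 hle htot.summable
  refine ⟨hF, ?_⟩
  have hup := hasSum_le hle hF.hasSum htot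
  have hlow := hF.sum_le_tsum (Finset.Icc (-M) N) (fun n _ => h0 n)
  rw [abs_of_nonneg (by linarith)]
  linarith

end Tail

section SincQuadrature

theorem exp_mul_div_exp_add_le_exp_mul {a lam y : ℝ} (hlam : 1 ≤ lam) :
    Real.exp (a * y) / (Real.exp y + lam) ≤ Real.exp (a * y) :=
  div_le_self (Real.exp_pos _).le (by linarith [Real.exp_pos y])

theorem exp_mul_div_exp_add_le_exp_neg_mul {a lam y : ℝ} (hlam : 0 ≤ lam) :
    Real.exp (a * y) / (Real.exp y + lam) ≤ Real.exp (-((1 - a) * y)) := by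
  have h : Real.exp (-((1 - a) * y)) = Real.exp (a * y) / Real.exp y := by
    rw [← Real.exp_sub]
    ring_nf
  rw [h]
  gcongr
  linarith

open Asymptotics Filter in
theorem isBigO_exp_mul_div_exp_add_one {a k : ℝ} (ha : a ∈ Ioo (0 : ℝ) 1) (hk : 0 < k) (b : ℝ) :
    (fun v : ℝ => ((Real.exp (a * (k * v)) / (Real.exp (k * v) + 1) : ℝ) : ℂ))
      =O[cocompact ℝ] (|·| ^ b) := by
  have hc : 0 < min a (1 - a) * k := mul_pos (lt_min ha.1 (sub_pos.2 ha.2)) hk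
  have h := ((isLittleO_exp_neg_mul_rpow_atTop hc b).isBigO).comp_tendsto
    (tendsto_norm_cocompact_atTop (E := ℝ))
  refine (IsBigO.of_bound 1 (Eventually.of_forall fun v => ?_)).trans h
  have hpos : 0 ≤ Real.exp (a * (k * v)) / (Real.exp (k * v) + 1) := by positivity
  rw [Complex.norm_real, Real.norm_of_nonneg hpos, one_mul, Function.comp_apply, Real.norm_eq_abs,
    abs_of_pos (Real.exp_pos _), Real.norm_eq_abs]
  rcases le_total 0 v with hv | hv
  · refine (exp_mul_div_exp_add_le_exp_neg_mul zero_le_one).trans (Real.exp_le_exp.2 ?_)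
    rw [abs_of_nonneg hv]
    have := mul_le_mul_of_nonneg_right (min_le_right a (1 - a)) (mul_nonneg hk.le hv)
    linarith
  · refine (exp_mul_div_exp_add_le_exp_mul le_rfl).trans (Real.exp_le_exp.2 ?_)
    rw [abs_of_nonpos hv]
    have := mul_le_mul_of_nonneg_right (min_le_left a (1 - a))
      (mul_nonneg hk.le (neg_nonneg.2 hv))
    linarith

open FourierTransform in
theorem fourier_exp_mul_div_exp_add_one {a k : ℝ} (ha : a ∈ Ioo (0 : ℝ) 1) (hk : 0 < k) (ξ : ℝ) :
    𝓕 (fun v : ℝ => ((Real.exp (a * (k * v)) / (Real.exp (k * v) + 1) : ℝ) : ℂ)) ξ =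
      (k : ℂ)⁻¹ * (π / Complex.sin (π * (a - (2 * π * ξ / k : ℝ) * Complex.I))) := by
  rw [← integral_cexp_mul_div_exp_add_one (by simpa using ha.1) (by simpa using ha.2),
    Real.fourier_real_eq_integral_exp_smul]
  have h := MeasureTheory.Measure.integral_comp_mul_left (fun y : ℝ =>
    Complex.exp ((a - (2 * π * ξ / k : ℝ) * Complex.I) * y) / (Complex.exp y + 1)) k
  rw [abs_of_pos (inv_pos.2 hk), Complex.real_smul, Complex.ofReal_inv] at h
  rw [← h]
  congr 1 with v
  have hk' : (k : ℂ) ≠ 0 := Complex.ofReal_ne_zero.2 hk.ne'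
  push_cast
  rw [smul_eq_mul, mul_div_assoc', ← Complex.exp_add]
  congr 2
  field_simp
  ring

theorem norm_fourier_term_le {a k : ℝ} (hk : k ∈ Ioc (0 : ℝ) 1) {n : ℤ} (hn : n ≠ 0) :
    ‖(π / Complex.sin (π * (a - (2 * π * n / k : ℝ) * Complex.I)) : ℂ)‖ ≤
      4 * π * Real.exp (-π ^ 2 / (4 * k)) * Real.exp (-|(n : ℝ)|) := by
  obtain ⟨hk0, hk1⟩ := hk
  have hn1 : (1 : ℝ) ≤ |(n : ℝ)| := by exact_mod_cast Int.one_le_abs hn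
  have hpi := Real.pi_gt_three
  set z : ℂ := π * (a - (2 * π * n / k : ℝ) * Complex.I) with hz
  have him : |z.im| = 2 * π ^ 2 / k * |(n : ℝ)| := by
    have : z.im = -(2 * π ^ 2 / k * n) := by
      simp only [hz, Complex.mul_im, Complex.sub_im, Complex.ofReal_re, Complex.ofReal_im,
        Complex.I_re, Complex.I_im, Complex.sub_re, Complex.mul_re]
      ring
    rw [this, abs_neg, abs_mul, abs_of_pos (by positivity)]
  have hlow : π ^ 2 / (4 * k) + |(n : ℝ)| ≤ |z.im| := by
    have h1 : 1 ≤ π ^ 2 / k := by rw [le_div_iff₀ hk0]; nlinarith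
    have h2 : π ^ 2 / (4 * k) = π ^ 2 / k / 4 := by field_simp
    have h3 : 2 * π ^ 2 / k = 2 * (π ^ 2 / k) := by ring
    rw [him, h2, h3]
    nlinarith
  have hsin := exp_abs_im_div_four_le_norm_sin (z := z)
    (by linarith [show 0 ≤ π ^ 2 / (4 * k) by positivity])
  have hexp : Real.exp (-|z.im|) ≤ Real.exp (-π ^ 2 / (4 * k)) * Real.exp (-|(n : ℝ)|) := by
    rw [← Real.exp_add, neg_div]
    exact Real.exp_le_exp.2 (by linarith)
  rw [norm_div, Complex.norm_real, Real.norm_of_nonneg Real.pi_pos.le]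
  calc π / ‖Complex.sin z‖ ≤ π / (Real.exp |z.im| / 4) := by gcongr
    _ = 4 * π * Real.exp (-|z.im|) := by rw [Real.exp_neg]; field_simp
    _ ≤ _ := by rw [mul_assoc (4 * π)]; gcongr

theorem summable_exp_neg_abs_int : Summable fun n : ℤ => Real.exp (-|(n : ℝ)|) :=
  (summable_and_abs_tsum_sub_sum_Icc_le one_pos one_pos (fun n => (Real.exp_pos _).le)
    (fun n => Real.exp_le_exp.2 (by linarith [le_abs_self (n : ℝ)]))
    (fun n => Real.exp_le_exp.2 (by linarith [neg_le_abs (n : ℝ)])) 0 0).1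

open FourierTransform in
/-- Exponential accuracy of the shifted bi-infinite trapezoidal rule, by Poisson summation. -/
theorem abs_trapezoidal_sub_integral_le {a k : ℝ} (ha : a ∈ Ioo (0 : ℝ) 1)
    (hk : k ∈ Ioc (0 : ℝ) 1) (x : ℝ) :
    |k * ∑' n : ℤ, Real.exp (a * (k * (x + n))) / (Real.exp (k * (x + n)) + 1)
        - π / Real.sin (π * a)| ≤
      4 * π * (∑' n : ℤ, Real.exp (-|(n : ℝ)|)) * Real.exp (-π ^ 2 / (4 * k)) := by
  have hk0 : (k : ℂ) ≠ 0 := Complex.ofReal_ne_zero.2 hk.1.ne'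
  set f : ℝ → ℂ := fun v => ((Real.exp (a * (k * v)) / (Real.exp (k * v) + 1) : ℝ) : ℂ) with hf
  set D : ℤ → ℂ := fun n => k * (𝓕 f n * fourier n (x : UnitAddCircle)) with hD
  have hDn : ∀ n : ℤ, D n = π / Complex.sin (π * (a - (2 * π * n / k : ℝ) * Complex.I)) *
      fourier n (x : UnitAddCircle) := by
    intro n
    rw [hD]
    simp only
    rw [hf, fourier_exp_mul_div_exp_add_one ha hk.1]
    field_simp
  have hnorm : ∀ n : ℤ, ‖(fourier n (x : UnitAddCircle) : ℂ)‖ = 1 := fun n => by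
    rw [fourier_apply]
    exact Circle.norm_coe _
  have hbound : ∀ n : ℤ, ‖if n = 0 then 0 else D n‖ ≤
      4 * π * Real.exp (-π ^ 2 / (4 * k)) * Real.exp (-|(n : ℝ)|) := by
    intro n
    split_ifs with hn
    · rw [norm_zero]; positivity
    · rw [hDn, norm_mul, hnorm, mul_one]
      exact norm_fourier_term_le hk hn
  have hsum := summable_exp_neg_abs_int.hasSum.mul_left (4 * π * Real.exp (-π ^ 2 / (4 * k)))
  have hDs : Summable D := by
    have h := Summable.of_norm_bounded hsum.summable hbound
    rw [← (Set.finite_singleton (0 : ℤ)).summable_compl_iff] at h ⊢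
    refine h.congr fun n => ?_
    exact if_neg n.2
  have hFs : Summable fun n : ℤ => 𝓕 f n := by
    refine Summable.of_norm ?_
    have h := (hDs.mul_left (k : ℂ)⁻¹).norm
    refine h.congr fun n => ?_
    rw [hD]
    simp only
    rw [inv_mul_cancel_left₀ hk0, norm_mul, hnorm, mul_one]
  have hcont : Continuous f := by
    rw [hf]
    refine Complex.continuous_ofReal.comp ?_
    exact Continuous.div (by fun_prop) (by fun_prop) fun v => by positivity
  have hpoisson := Real.tsum_eq_tsum_fourier_of_rpow_decay_of_summable hcont one_lt_two
    (isBigO_exp_mul_div_exp_add_one ha hk.1 _) hFs x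
  have hmain : ((k * ∑' n : ℤ, Real.exp (a * (k * (x + n))) / (Real.exp (k * (x + n)) + 1)
      - π / Real.sin (π * a) : ℝ) : ℂ) = ∑' n : ℤ, if n = 0 then 0 else D n := by
    have h1 := hDs.tsum_eq_add_tsum_ite 0
    have h0 : D 0 = ((π / Real.sin (π * a) : ℝ) : ℂ) := by
      rw [hDn]
      simp
    rw [hD, tsum_mul_left, ← hpoisson, ← hD, h0] at h1
    rw [Complex.ofReal_sub, Complex.ofReal_mul, Complex.ofReal_tsum, sub_eq_iff_eq_add', ← h1, hf]
  rw [← Real.norm_eq_abs, ← Complex.norm_real, hmain]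
  refine (tsum_of_norm_bounded hsum hbound).trans (le_of_eq ?_)
  ring

end SincQuadrature

/-- Exponential convergence of the sinc quadrature for the scalar Balakrishnan formula:
for `s ∈ (0,1)` there is `C > 0` (depending only on `s`) such that for every
`k ∈ (0,1]` and every `λ ≥ 1`, with `N₊ = ⌈π²/(4sk²)⌉` and `N₋ = ⌈π²/(4(1-s)k²)⌉`,
`|λ^(-s) - (sin(sπ)/π) k Σ_{ℓ=-N₋}^{N₊} e^((1-s)kℓ)/(e^(kℓ)+λ)| ≤ C e^(-π²/(4k))`. -/
theorem sinc_quadrature_scalar (s : ℝ) (hs : s ∈ Set.Ioo (0 : ℝ) 1) :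
    ∃ C : ℝ, 0 < C ∧
      ∀ k : ℝ, k ∈ Set.Ioc (0 : ℝ) 1 → ∀ lam : ℝ, 1 ≤ lam →
        |lam ^ (-s) -
            Real.sin (s * π) / π * k *
              ∑ ℓ ∈ Finset.Icc (-(⌈π ^ 2 / (4 * (1 - s) * k ^ 2)⌉ : ℤ))
                  (⌈π ^ 2 / (4 * s * k ^ 2)⌉ : ℤ),
                Real.exp ((1 - s) * (k * (ℓ : ℝ))) / (Real.exp (k * (ℓ : ℝ)) + lam)| ≤
          C * Real.exp (-π ^ 2 / (4 * k)) := by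
  obtain ⟨hs0, hs1⟩ := hs
  have h1s : 0 < 1 - s := sub_pos.2 hs1
  set S := ∑' n : ℤ, Real.exp (-|(n : ℝ)|)
  have hS : 0 ≤ S := tsum_nonneg fun n => (Real.exp_pos _).le
  refine ⟨4 * π * S + (1 / s + 1 / (1 - s)), by positivity, fun k hk lam hlam => ?_⟩
  have hk0 := hk.1
  have hlam0 : 0 < lam := by linarith
  set N := ⌈π ^ 2 / (4 * s * k ^ 2)⌉
  set M := ⌈π ^ 2 / (4 * (1 - s) * k ^ 2)⌉
  set E := Real.exp (-π ^ 2 / (4 * k))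
  set F : ℤ → ℝ := fun ℓ => Real.exp ((1 - s) * (k * ℓ)) / (Real.exp (k * ℓ) + lam) with hF
  have hnode : ∀ {c : ℝ}, 0 < c → Real.exp (-(c * k * ⌈π ^ 2 / (4 * c * k ^ 2)⌉)) ≤ E := by
    intro c hc
    refine Real.exp_le_exp.2 ?_
    have h := mul_le_mul_of_nonneg_left (Int.le_ceil (π ^ 2 / (4 * c * k ^ 2)))
      (mul_pos hc hk0).le
    have h2 : c * k * (π ^ 2 / (4 * c * k ^ 2)) = π ^ 2 / (4 * k) := by field_simp
    rw [neg_div]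
    linarith
  have htail : |k * (∑' n, F n - ∑ n ∈ Finset.Icc (-M) N, F n)| ≤ (1 / s + 1 / (1 - s)) * E := by
    have h := (summable_and_abs_tsum_sub_sum_Icc_le (F := F) (mul_pos hs0 hk0) (mul_pos h1s hk0)
      (fun n => by positivity)
      (fun n => (exp_mul_div_exp_add_le_exp_neg_mul hlam0.le).trans (le_of_eq (by ring_nf)))
      (fun n => (exp_mul_div_exp_add_le_exp_mul hlam).trans (le_of_eq (by ring_nf))) M N).2
    rw [abs_mul, abs_of_pos hk0]
    calc k * |∑' n, F n - ∑ n ∈ Finset.Icc (-M) N, F n| ≤ k * (E / (s * k) + E / ((1 - s) * k)) := by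
          refine mul_le_mul_of_nonneg_left (h.trans ?_) hk0.le
          gcongr
          · exact hnode hs0
          · exact hnode h1s
      _ = (1 / s + 1 / (1 - s)) * E := by field_simp
  have hscale : ∀ n : ℤ, F n = lam ^ (-s) * (Real.exp ((1 - s) * (k * (-Real.log lam / k + n))) /
      (Real.exp (k * (-Real.log lam / k + n)) + 1)) := by
    intro n
    have h1 : k * (-Real.log lam / k + n) = k * n - Real.log lam := by field_simp; ring
    rw [h1, mul_sub, Real.exp_sub, Real.exp_sub, Real.exp_log hlam0, hF,
      Real.rpow_def_of_pos hlam0]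
    have h2 : Real.exp (Real.log lam * -s) = Real.exp ((1 - s) * Real.log lam) / lam := by
      rw [eq_div_iff hlam0.ne']
      nth_rewrite 2 [← Real.exp_log hlam0]
      rw [← Real.exp_add]
      ring_nf
    rw [h2]
    have := Real.exp_pos (k * n)
    field_simp
  have hsin : 0 < Real.sin (s * π) :=
    Real.sin_pos_of_pos_of_lt_pi (by positivity) (by nlinarith [Real.pi_pos])
  have hsymm : Real.sin (π * (1 - s)) = Real.sin (s * π) := by
    rw [← Real.sin_pi_sub]
    ring_nf
  have htrap := abs_trapezoidal_sub_integral_le ⟨h1s, by linarith⟩ hk (-Real.log lam / k)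
  rw [hsymm] at htrap
  have hpow : lam ^ (-s) ≤ 1 := Real.rpow_le_one_of_one_le_of_nonpos hlam (by linarith)
  have hpow0 : 0 < lam ^ (-s) := Real.rpow_pos_of_pos hlam0 _
  have hfac : Real.sin (s * π) / π ≤ 1 := by
    rw [div_le_one Real.pi_pos]
    linarith [Real.sin_le_one (s * π), Real.pi_gt_three]
  set T := ∑' n : ℤ, Real.exp ((1 - s) * (k * (-Real.log lam / k + n))) /
      (Real.exp (k * (-Real.log lam / k + n)) + 1)
  have hT : ∑' n, F n = lam ^ (-s) * T := by
    rw [← tsum_mul_left]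
    exact tsum_congr hscale
  have hsplit : lam ^ (-s) - Real.sin (s * π) / π * k * ∑ n ∈ Finset.Icc (-M) N, F n =
      Real.sin (s * π) / π * (-(lam ^ (-s) * (k * T - π / Real.sin (s * π))) +
        k * (∑' n, F n - ∑ n ∈ Finset.Icc (-M) N, F n)) := by
    rw [hT]
    field_simp
    ring
  change |lam ^ (-s) - Real.sin (s * π) / π * k * ∑ n ∈ Finset.Icc (-M) N, F n| ≤ _
  rw [hsplit, abs_mul, abs_of_pos (div_pos hsin Real.pi_pos)]
  refine (mul_le_of_le_one_left (abs_nonneg _) hfac).trans ((abs_add_le _ _).trans ?_)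
  rw [abs_neg, abs_mul, abs_of_pos hpow0, add_mul]
  exact add_le_add ((mul_le_of_le_one_left (abs_nonneg _) hpow).trans htrap) htail
end
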